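/- arXiv:1111.0796 — 4 statements merged into one kernel-verified Lean document; each statement's English description precedes it below -/
import Mathlib

section
/- Let s ∈ (0,1) and let f : ℝ → ℝ be of class C^{1,γ} for some γ > max(0, 1−2s), with f′(−1) < 0 and f′(1) < 0. If v₁ and v₂ are two layer solutions of (-∂ₓₓ)^s v = f(v) in ℝ, then there exists b ∈ ℝ such that v₂(x) = v₁(x + b) for all x ∈ ℝ (the layer solution is unique up to translations). -/
open Real MeasureTheory Filter Set

/-- Normalizing constant of the one-dimensional fractional Laplacian. -/
noncomputable def fracLapCoef (s : ℝ) : ℝ :=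
  (4:ℝ) ^ s * s * Real.Gamma (s + 1/2) / (Real.sqrt π * Real.Gamma (1 - s))

/-- The one-dimensional fractional Laplacian `(-∂ₓₓ)^s v (x)`. -/
noncomputable def fracLap (s : ℝ) (v : ℝ → ℝ) (x : ℝ) : ℝ :=
  fracLapCoef s * ∫ y in Set.Ioi (0:ℝ), (2 * v x - v (x + y) - v (x - y)) * y ^ (-1 - 2*s)

/-- `f` is of class `C^{1,γ}`: continuously differentiable with `γ`-Hölder derivative. -/
def IsC1Holder (γ : ℝ) (f : ℝ → ℝ) : Prop :=
  ContDiff ℝ 1 f ∧ ∃ C : ℝ, ∀ x y : ℝ, |deriv f x - deriv f y| ≤ C * |x - y| ^ γ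

/-- A layer solution of `(-∂ₓₓ)^s v = f(v)` in `ℝ`. -/
structure IsLayerSolution (s : ℝ) (f : ℝ → ℝ) (v : ℝ → ℝ) : Prop where
  bounded : ∃ M : ℝ, ∀ x, |v x| ≤ M
  smooth : ContDiff ℝ 2 v
  eqn : ∀ x, fracLap s v x = f (v x)
  mono : ∀ x, 0 < deriv v x
  limNeg : Tendsto v atBot (nhds (-1))
  limPos : Tendsto v atTop (nhds 1)

/-- The potential `G(r) = -∫₀^r f`. -/
noncomputable def potG (f : ℝ → ℝ) (r : ℝ) : ℝ := -∫ u in (0:ℝ)..r, f u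

lemma secondDiff_bound (v : ℝ → ℝ) (hv : ContDiff ℝ 2 v) (x : ℝ) :
    ∃ K : ℝ, ∀ y : ℝ, 0 < y → y ≤ 1 → |2 * v x - v (x + y) - v (x - y)| ≤ K * y ^ 2 := by
  have hd : Differentiable ℝ v := hv.differentiable (by norm_num)
  have hv' : ContDiff ℝ 1 (deriv v) := by
    have h : ContDiff ℝ (1 + 1) v := by
      have e : (1 + 1 : WithTop ℕ∞) = 2 := by norm_num
      rw [e]; exact hv
    exact (contDiff_succ_iff_deriv.1 h).2.2
  have hd' : Differentiable ℝ (deriv v) := hv'.differentiable (by norm_num)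
  have hc : Continuous (deriv (deriv v)) := hv'.continuous_deriv (by norm_num)
  obtain ⟨K, hK⟩ := (isCompact_Icc (a := x - 1) (b := x + 1)).exists_bound_of_continuousOn
    hc.continuousOn
  have hK0 : 0 ≤ K := (norm_nonneg _).trans (hK x ⟨by linarith, by linarith⟩)
  refine ⟨2 * K, fun y hy0 hy1 => ?_⟩
  have hg : ∀ z : ℝ, HasDerivAt (fun z => v (x + z) + v (x - z))
      (deriv v (x + z) - deriv v (x - z)) z := by
    intro z
    have h1 : HasDerivAt (fun z => v (x + z)) (deriv v (x + z)) z :=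
      (hd (x + z)).hasDerivAt.comp_const_add x z
    have h2 : HasDerivAt (fun z => v (x - z)) (-deriv v (x - z)) z :=
      (hd (x - z)).hasDerivAt.comp_const_sub x z
    have := h1.add h2
    rw [sub_eq_add_neg]
    exact this
  have hb : ∀ z ∈ Icc (0:ℝ) y, ‖deriv v (x + z) - deriv v (x - z)‖ ≤ 2 * K * y := by
    intro z hz
    have := (convex_Icc (x - 1) (x + 1)).norm_image_sub_le_of_norm_deriv_le (f := deriv v)
      (fun w _ => hd' w) hK (x := x - z) (y := x + z)
      ⟨by linarith [hz.1, hz.2], by linarith [hz.1, hz.2]⟩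
      ⟨by linarith [hz.1, hz.2], by linarith [hz.1, hz.2]⟩
    refine this.trans ?_
    have e : x + z - (x - z) = 2 * z := by ring
    rw [e, Real.norm_eq_abs, abs_of_nonneg (by linarith [hz.1])]
    nlinarith [hz.1, hz.2]
  have := (convex_Icc (0:ℝ) y).norm_image_sub_le_of_norm_hasDerivWithin_le
    (fun z _ => (hg z).hasDerivWithinAt) hb (x := 0) (y := y) ⟨le_rfl, hy0.le⟩ ⟨hy0.le, le_rfl⟩
  simp only [add_zero, sub_zero, Real.norm_eq_abs, abs_of_pos hy0] at this
  rw [abs_sub_comm] at this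
  calc _ = |v x + v x - (v (x + y) + v (x - y))| := by congr 1; ring
    _ ≤ _ := this
    _ = _ := by ring

lemma fracLap_integrable (s : ℝ) (hs : s ∈ Set.Ioo (0:ℝ) 1) (v : ℝ → ℝ) (hv : ContDiff ℝ 2 v)
    (hb : ∃ M : ℝ, ∀ x, |v x| ≤ M) (x : ℝ) :
    IntegrableOn (fun y => (2 * v x - v (x + y) - v (x - y)) * y ^ (-1 - 2*s)) (Ioi (0:ℝ)) := by
  obtain ⟨M, hM⟩ := hb
  obtain ⟨K, hK⟩ := secondDiff_bound v hv x
  have hc : Continuous v := hv.continuous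
  have hmeas : ∀ t : Set ℝ, AEStronglyMeasurable
      (fun y => (2 * v x - v (x + y) - v (x - y)) * y ^ (-1 - 2*s)) (volume.restrict t) := by
    intro t
    apply Measurable.aestronglyMeasurable
    have : Measurable v := hc.measurable
    fun_prop
  rw [← Ioc_union_Ioi_eq_Ioi (zero_le_one (α := ℝ))]
  apply IntegrableOn.union
  · have hi : IntegrableOn (fun y : ℝ => K * y ^ (1 - 2 * s)) (Ioc 0 1) := by
      have := intervalIntegral.intervalIntegrable_rpow' (a := 0) (b := 1) (r := 1 - 2*s)
        (by linarith [hs.2])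
      exact ((intervalIntegrable_iff_integrableOn_Ioc_of_le zero_le_one).1 this).const_mul K
    refine Integrable.mono' hi (hmeas _) ?_
    refine (ae_restrict_iff' measurableSet_Ioc).2 (Eventually.of_forall fun y hy => ?_)
    have hp : 0 ≤ y ^ (-1 - 2*s) := Real.rpow_nonneg hy.1.le _
    rw [Real.norm_eq_abs, abs_mul, abs_of_nonneg hp]
    calc _ ≤ K * y ^ 2 * y ^ (-1 - 2*s) := mul_le_mul_of_nonneg_right (hK y hy.1 hy.2) hp
      _ = K * y ^ (1 - 2*s) := by
        rw [mul_assoc, ← Real.rpow_natCast y 2, ← Real.rpow_add hy.1]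
        congr 2; push_cast; ring
  · have hi : IntegrableOn (fun y : ℝ => 4 * M * y ^ (-1 - 2 * s)) (Ioi 1) :=
      (integrableOn_Ioi_rpow_of_lt (by linarith [hs.1]) zero_lt_one).const_mul _
    refine Integrable.mono' hi (hmeas _) ?_
    refine (ae_restrict_iff' measurableSet_Ioi).2 (Eventually.of_forall fun y hy => ?_)
    have hy0 : (0:ℝ) < y := zero_lt_one.trans hy
    have hp : 0 ≤ y ^ (-1 - 2*s) := Real.rpow_nonneg hy0.le _
    rw [Real.norm_eq_abs, abs_mul, abs_of_nonneg hp]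
    refine mul_le_mul_of_nonneg_right ?_ hp
    have h1 := abs_le.1 (hM x)
    have h2 := abs_le.1 (hM (x + y))
    have h3 := abs_le.1 (hM (x - y))
    rw [abs_le]; constructor <;> linarith

lemma fracLapCoef_pos (s : ℝ) (hs : s ∈ Set.Ioo (0:ℝ) 1) : 0 < fracLapCoef s := by
  have h1 : 0 < Real.Gamma (s + 1/2) := Real.Gamma_pos_of_pos (by linarith [hs.1])
  have h2 : 0 < Real.Gamma (1 - s) := Real.Gamma_pos_of_pos (by linarith [hs.2])
  have h3 := hs.1
  unfold fracLapCoef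
  positivity

/-- Strong maximum principle. -/
lemma strong_max (s : ℝ) (hs : s ∈ Set.Ioo (0:ℝ) 1) (u v : ℝ → ℝ)
    (hu : ContDiff ℝ 2 u) (hv : ContDiff ℝ 2 v)
    (hub : ∃ M : ℝ, ∀ x, |u x| ≤ M) (hvb : ∃ M : ℝ, ∀ x, |v x| ≤ M) (x₀ : ℝ)
    (hmin : ∀ x, u x₀ - v x₀ ≤ u x - v x) (hL : fracLap s v x₀ ≤ fracLap s u x₀) :
    ∀ x, u x - v x = u x₀ - v x₀ := by
  have hC := fracLapCoef_pos s hs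
  have iu := fracLap_integrable s hs u hu hub x₀
  have iv := fracLap_integrable s hs v hv hvb x₀
  have hle := le_of_mul_le_mul_left hL hC
  have isub := iv.sub iu
  have hnn : ∀ y ∈ Ioi (0:ℝ), 0 ≤ ((fun y => (2 * v x₀ - v (x₀ + y) - v (x₀ - y)) * y ^ (-1 - 2*s)) -
      (fun y => (2 * u x₀ - u (x₀ + y) - u (x₀ - y)) * y ^ (-1 - 2*s))) y := by
    intro y hy
    have hp : 0 ≤ y ^ (-1 - 2*s) := Real.rpow_nonneg (le_of_lt hy) _
    simp only [Pi.sub_apply, ← sub_mul]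
    refine mul_nonneg ?_ hp
    linarith [hmin (x₀ + y), hmin (x₀ - y)]
  have hae := (ae_restrict_iff' (μ := volume) measurableSet_Ioi).2 (Eventually.of_forall hnn)
  have hint : ∫ y in Ioi (0:ℝ), ((fun y => (2 * v x₀ - v (x₀ + y) - v (x₀ - y)) * y ^ (-1 - 2*s)) -
      (fun y => (2 * u x₀ - u (x₀ + y) - u (x₀ - y)) * y ^ (-1 - 2*s))) y = 0 := by
    apply le_antisymm
    · rw [integral_sub' iv iu]; linarith
    · exact integral_nonneg_of_ae hae
  have hz := (integral_eq_zero_iff_of_nonneg_ae hae isub).1 hint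
  have hcu := hu.continuous
  have hcv := hv.continuous
  have hcont : ContinuousOn ((fun y => (2 * v x₀ - v (x₀ + y) - v (x₀ - y)) * y ^ (-1 - 2*s)) -
      (fun y => (2 * u x₀ - u (x₀ + y) - u (x₀ - y)) * y ^ (-1 - 2*s))) (Ioi (0:ℝ)) := by
    have hp : ContinuousOn (fun y : ℝ => y ^ (-1 - 2*s)) (Ioi 0) := fun y hy =>
      (Real.continuousAt_rpow_const y _ (Or.inl (ne_of_gt hy))).continuousWithinAt
    apply ContinuousOn.sub
    · exact ContinuousOn.mul (by fun_prop) hp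
    · exact ContinuousOn.mul (by fun_prop) hp
  have heq := Measure.eqOn_open_of_ae_eq hz isOpen_Ioi hcont continuousOn_const
  have key : ∀ y : ℝ, 0 < y → u (x₀ + y) - v (x₀ + y) = u x₀ - v x₀ ∧
      u (x₀ - y) - v (x₀ - y) = u x₀ - v x₀ := by
    intro y hy
    have h := heq hy
    have hp : 0 < y ^ (-1 - 2*s) := Real.rpow_pos_of_pos hy _
    simp only [Pi.sub_apply, ← sub_mul, Pi.zero_apply] at h
    have h' := (mul_eq_zero.1 h).resolve_right hp.ne'
    constructor <;> linarith [hmin (x₀ + y), hmin (x₀ - y)]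
  intro x
  rcases lt_trichotomy x x₀ with h | h | h
  · have := (key (x₀ - x) (by linarith)).2
    rwa [sub_sub_cancel] at this
  · rw [h]
  · have := (key (x - x₀) (by linarith)).1
    rwa [add_sub_cancel] at this

lemma antitone_near (f : ℝ → ℝ) (hf : ContDiff ℝ 1 f) (a : ℝ) (ha : deriv f a < 0) :
    ∃ δ > 0, AntitoneOn f (Icc (a - δ) (a + δ)) := by
  have hc : Continuous (deriv f) := hf.continuous_deriv (by norm_num)
  have hev := hc.continuousAt.eventually (gt_mem_nhds ha)
  obtain ⟨ε, hε, h⟩ := Metric.eventually_nhds_iff.1 hev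
  have hd : Differentiable ℝ f := hf.differentiable (by norm_num)
  refine ⟨ε / 2, by linarith, antitoneOn_of_deriv_nonpos (convex_Icc _ _)
    hf.continuous.continuousOn hd.differentiableOn ?_⟩
  intro x hx
  rw [interior_Icc] at hx
  refine (h ?_).le
  rw [Real.dist_eq, abs_lt]
  constructor <;> linarith [hx.1, hx.2]

lemma IsLayerSolution.strictMono {s : ℝ} {f v : ℝ → ℝ} (h : IsLayerSolution s f v) :
    StrictMono v := strictMono_of_deriv_pos h.mono

lemma IsLayerSolution.lt_one {s : ℝ} {f v : ℝ → ℝ} (h : IsLayerSolution s f v) (x : ℝ) :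
    v x < 1 :=
  (h.strictMono (lt_add_one x)).trans_le (h.strictMono.monotone.ge_of_tendsto h.limPos _)

lemma IsLayerSolution.gt_neg_one {s : ℝ} {f v : ℝ → ℝ} (h : IsLayerSolution s f v) (x : ℝ) :
    -1 < v x :=
  (h.strictMono.monotone.le_of_tendsto h.limNeg (x - 1)).trans_lt (h.strictMono (sub_one_lt x))

lemma IsLayerSolution.translate {s : ℝ} {f v : ℝ → ℝ} (h : IsLayerSolution s f v) (t : ℝ) :
    IsLayerSolution s f (fun x => v (x + t)) where
  bounded := by
    obtain ⟨M, hM⟩ := h.bounded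
    exact ⟨M, fun x => hM _⟩
  smooth := h.smooth.comp (contDiff_id.add contDiff_const)
  eqn := fun x => by
    rw [← h.eqn (x + t)]
    unfold fracLap
    congr 2
    ext y
    beta_reduce
    rw [show x + y + t = x + t + y by ring, show x - y + t = x + t - y by ring]
  mono := fun x => by
    rw [deriv_comp_add_const]
    exact h.mono _
  limNeg := h.limNeg.comp (tendsto_atBot_add_const_right _ t tendsto_id)
  limPos := h.limPos.comp (tendsto_atTop_add_const_right _ t tendsto_id)

/-- Comparison: positivity on a compact set propagates. -/
lemma compare {s : ℝ} (hs : s ∈ Set.Ioo (0:ℝ) 1) {f u v : ℝ → ℝ} (hu : IsLayerSolution s f u)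
    (hv : IsLayerSolution s f v) {δ₁ δ₂ M : ℝ} (h1 : AntitoneOn f (Icc (1 - δ₁) (1 + δ₁)))
    (h2 : AntitoneOn f (Icc (-1 - δ₂) (-1 + δ₂))) (hδ₁ : 0 < δ₁) (hδ₂ : 0 < δ₂)
    (hp : ∀ x, M < x → 1 - δ₁ ≤ u x) (hm : ∀ x, x < -M → v x ≤ -1 + δ₂)
    (hK : ∀ x ∈ Icc (-M) M, v x ≤ u x) : ∀ x, v x ≤ u x := by
  by_contra! hcon
  obtain ⟨a, ha⟩ := hcon
  have hc : Continuous (fun x => u x - v x) := hu.smooth.continuous.sub hv.smooth.continuous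
  have lN : Tendsto (fun x => u x - v x) atBot (nhds 0) := by
    simpa using hu.limNeg.sub hv.limNeg
  have lP : Tendsto (fun x => u x - v x) atTop (nhds 0) := by
    simpa using hu.limPos.sub hv.limPos
  have hneg : u a - v a < 0 := by linarith
  obtain ⟨x₀, hx₀⟩ := hc.exists_forall_le' a (by
    rw [cocompact_eq_atBot_atTop]
    have e1 := lN.eventually (lt_mem_nhds hneg)
    have e2 := lP.eventually (lt_mem_nhds hneg)
    exact (eventually_sup.2 ⟨e1, e2⟩).mono fun x hx => hx.le)
  have hx0 : u x₀ - v x₀ < 0 := (hx₀ a).trans_lt hneg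
  have hf : f (v x₀) ≤ f (u x₀) := by
    have b1 := hu.gt_neg_one x₀
    have b2 := hv.lt_one x₀
    by_cases c1 : M < x₀
    · have := hp x₀ c1
      exact h1 ⟨by linarith, by linarith⟩ ⟨by linarith, by linarith⟩ (by linarith)
    by_cases c2 : x₀ < -M
    · have := hm x₀ c2
      exact h2 ⟨by linarith, by linarith⟩ ⟨by linarith, by linarith⟩ (by linarith)
    have := hK x₀ ⟨not_lt.1 c2, not_lt.1 c1⟩
    linarith
  have hconst := strong_max s hs u v hu.smooth hv.smooth hu.bounded hv.bounded x₀ hx₀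
    (by rw [hu.eqn, hv.eqn]; exact hf)
  have e2 := lP.eventually (lt_mem_nhds hx0)
  obtain ⟨z, hz⟩ := e2.exists
  linarith [hconst z]

/-- Uniqueness of the layer solution up to translations. -/
theorem statement2 (s γ : ℝ) (hs : s ∈ Set.Ioo (0:ℝ) 1)
    (hγ : max 0 (1 - 2*s) < γ)
    (f : ℝ → ℝ) (hf : IsC1Holder γ f)
    (hfm : deriv f (-1) < 0) (hfp : deriv f 1 < 0)
    (v₁ v₂ : ℝ → ℝ)
    (h₁ : IsLayerSolution s f v₁) (h₂ : IsLayerSolution s f v₂) :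
    ∃ b : ℝ, ∀ x : ℝ, v₂ x = v₁ (x + b) := by
  obtain ⟨δ₁, hδ₁, hA1⟩ := antitone_near f hf.1 1 hfp
  obtain ⟨δ₂, hδ₂, hA2⟩ := antitone_near f hf.1 (-1) hfm
  have c1 : Continuous v₁ := h₁.smooth.continuous
  have c2 : Continuous v₂ := h₂.smooth.continuous
  obtain ⟨P, hP⟩ := eventually_atTop.1
    (h₁.limPos.eventually (lt_mem_nhds (show 1 - δ₁ < 1 by linarith)))
  obtain ⟨N, hN⟩ := eventually_atBot.1
    (h₂.limNeg.eventually (gt_mem_nhds (show -1 < -1 + δ₂ by linarith)))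
  -- general comparison for translates
  have comp : ∀ t M : ℝ, P - t ≤ M → -N ≤ M →
      (∀ x ∈ Icc (-M) M, v₂ x ≤ v₁ (x + t)) → ∀ x, v₂ x ≤ v₁ (x + t) := by
    intro t M hM1 hM2 hK
    exact compare hs (h₁.translate t) h₂ hA1 hA2 hδ₁ hδ₂
      (fun x hx => (hP (x + t) (by linarith)).le) (fun x hx => (hN x (by linarith)).le) hK
  set T : Set ℝ := {t | ∀ x, v₂ x ≤ v₁ (x + t)} with hT
  have hTne : T.Nonempty := by
    set M := max P (-N) with hM
    obtain ⟨Q, hQ⟩ := eventually_atTop.1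
      (h₁.limPos.eventually (lt_mem_nhds (h₂.lt_one M)))
    refine ⟨max 0 (Q + M), comp _ M ?_ (le_max_right _ _) ?_⟩
    · linarith [le_max_left P (-N), le_max_left 0 (Q + M)]
    · intro x hx
      have h3 := hQ (x + max 0 (Q + M)) (by linarith [hx.1, le_max_right 0 (Q + M)])
      exact (h₂.strictMono.monotone hx.2).trans h3.le
  have hTbdd : BddBelow T := by
    obtain ⟨Q, hQ⟩ := eventually_atBot.1
      (h₁.limNeg.eventually (gt_mem_nhds (h₂.gt_neg_one 0)))
    refine ⟨Q, fun t ht => ?_⟩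
    by_contra! hlt
    have h3 := ht 0
    rw [zero_add] at h3
    linarith [hQ t hlt.le]
  have hTcl : IsClosed T := by
    rw [hT, setOf_forall]
    exact isClosed_iInter fun x => isClosed_le continuous_const (by fun_prop)
  set b := sInf T with hb
  have hbT : b ∈ T := hTcl.csInf_mem hTne hTbdd
  refine ⟨b, ?_⟩
  by_cases hz : ∃ x₀, v₂ x₀ = v₁ (x₀ + b)
  · obtain ⟨x₀, hx₀⟩ := hz
    have hu := h₁.translate b
    have := strong_max s hs (fun x => v₁ (x + b)) v₂ hu.smooth h₂.smooth hu.bounded h₂.bounded x₀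
      (fun x => by have := hbT x; linarith)
      (by rw [hu.eqn, h₂.eqn, hx₀])
    intro x
    have := this x
    linarith
  · exfalso
    push Not at hz
    have hpos : ∀ x, v₂ x < v₁ (x + b) := fun x => lt_of_le_of_ne (hbT x) (hz x)
    set M := max (P - (b - 1)) (-N) with hM
    have hev : ∀ᶠ t in nhds b, ∀ x ∈ Icc (-M) M, v₂ x < v₁ (x + t) := by
      apply isCompact_Icc.eventually_forall_of_forall_eventually
      intro x _
      have hcF : Continuous (fun z : ℝ × ℝ => v₁ (z.2 + z.1)) := by fun_prop
      have hcG : Continuous (fun z : ℝ × ℝ => v₂ z.2) := by fun_prop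
      exact hcG.continuousAt.eventually_lt hcF.continuousAt (hpos x)
    obtain ⟨ε, hε, h⟩ := Metric.eventually_nhds_iff.1 hev
    set e := min (ε / 2) 1 with he
    have he0 : 0 < e := lt_min (by linarith) one_pos
    have he1 : e ≤ 1 := min_le_right _ _
    have he2 : e ≤ ε / 2 := min_le_left _ _
    have hmem : b - e ∈ T := by
      refine comp _ M ?_ (le_max_right _ _) fun x hx => (h ?_ x hx).le
      · linarith [le_max_left (P - (b - 1)) (-N)]
      · rw [Real.dist_eq, abs_lt]; constructor <;> linarith
    linarith [csInf_le hTbdd hmem]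
end

section
/- Let s ∈ (0,1) and let f : ℝ → ℝ be of class C^{1,γ} for some γ > max(0, 1−2s), with f′(−1) < 0 and f′(1) < 0. Let v be a layer solution of (-∂ₓₓ)^s v = f(v) in ℝ. Then there exist constants 0 < c ≤ C such that c |x|^{−1−2s} ≤ v′(x) ≤ C |x|^{−1−2s} for all x with |x| ≥ 1. -/
open Real MeasureTheory Filter Set

/-- The integral part of the fractional Laplacian. -/
noncomputable def layJ (s : ℝ) (u : ℝ → ℝ) (x : ℝ) : ℝ :=
  ∫ y in Set.Ioi (0:ℝ), (2 * u x - u (x + y) - u (x - y)) * y ^ (-1 - 2*s)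

/-- The barrier profile. -/
noncomputable def layg (s : ℝ) (x : ℝ) : ℝ := (1 + x^2) ^ (-(1/2 + s))

lemma coef_pos {s : ℝ} (hs : s ∈ Set.Ioo (0:ℝ) 1) : 0 < fracLapCoef s := by
  unfold fracLapCoef
  have h1 : 0 < Real.Gamma (s + 1/2) := Real.Gamma_pos_of_pos (by linarith [hs.1])
  have h2 : 0 < Real.Gamma (1 - s) := Real.Gamma_pos_of_pos (by linarith [hs.2])
  have h3 : 0 < Real.sqrt π := Real.sqrt_pos.2 Real.pi_pos
  have := hs.1
  positivity

lemma secdiff {u : ℝ → ℝ} (hu : ContDiff ℝ 2 u) {x y B : ℝ} (hy : 0 ≤ y)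
    (hB : ∀ z ∈ Icc (x - y) (x + y), |deriv (deriv u) z| ≤ B) :
    |2 * u x - u (x + y) - u (x - y)| ≤ 2 * B * y^2 := by
  have hd1 : Differentiable ℝ u := hu.differentiable (by norm_num)
  have hu1 : ContDiff ℝ 1 (deriv u) := by
    have : ContDiff ℝ (1+1) u := by simpa [one_add_one_eq_two] using hu
    exact (contDiff_succ_iff_deriv.1 this).2.2
  have hd2 : Differentiable ℝ (deriv u) := hu1.differentiable (by norm_num)
  have hB0 : 0 ≤ B := le_trans (abs_nonneg _) (hB x ⟨by linarith, by linarith⟩)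
  have key := norm_image_sub_le_of_norm_deriv_le_segment' (f := fun t => u (x + t) + u (x - t))
    (f' := fun t => deriv u (x + t) - deriv u (x - t)) (a := 0) (b := y) (C := 2 * B * y)
    (by
      intro t ht
      apply HasDerivAt.hasDerivWithinAt
      have h1 : HasDerivAt (fun t => u (x + t)) (deriv u (x + t)) t :=
        (hd1 (x + t)).hasDerivAt.comp_const_add x t
      have h2 : HasDerivAt (fun t => u (x - t)) (- deriv u (x - t)) t :=
        (hd1 (x - t)).hasDerivAt.comp_const_sub x t
      exact (h1.add h2).congr_deriv (by ring))
    (by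
      intro t ht
      have := Convex.norm_image_sub_le_of_norm_deriv_le (f := deriv u) (s := Icc (x - y) (x + y))
        (x := x - t) (y := x + t) (C := B) (fun z _ => hd2 z) (fun z hz => hB z hz)
        (convex_Icc _ _) ⟨by linarith [ht.2], by linarith [ht.1]⟩ ⟨by linarith [ht.1], by linarith [ht.2]⟩
      refine this.trans ?_
      rw [Real.norm_eq_abs, abs_of_nonneg (by linarith [ht.1])]
      nlinarith [ht.1, ht.2])
    y ⟨hy, le_refl _⟩
  simp only [add_zero, sub_zero, Real.norm_eq_abs] at key
  rw [← abs_neg]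
  calc _ = |u (x + y) + u (x - y) - (u x + u x)| := by congr 1; ring
    _ ≤ _ := key
    _ = _ := by ring

lemma int_near {s : ℝ} (hs : s ∈ Set.Ioo (0:ℝ) 1) :
    IntegrableOn (fun y : ℝ => y ^ (1 - 2*s)) (Ioc 0 1) :=
  (intervalIntegrable_iff_integrableOn_Ioc_of_le zero_le_one).1
    (intervalIntegral.intervalIntegrable_rpow' (by linarith [hs.2]))

lemma int_far {s : ℝ} (hs : s ∈ Set.Ioo (0:ℝ) 1) :
    IntegrableOn (fun y : ℝ => y ^ (-1 - 2*s)) (Ioi 1) :=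
  integrableOn_Ioi_rpow_of_lt (by linarith [hs.1]) one_pos

lemma sq_rpow {s y : ℝ} (hy : 0 < y) : y^2 * y ^ (-1 - 2*s) = y ^ (1 - 2*s) := by
  rw [← Real.rpow_natCast, ← Real.rpow_add hy]; congr 1; push_cast; ring

lemma meas_kernel {s : ℝ} {u : ℝ → ℝ} (hu : Continuous u) (x : ℝ) {S : Set ℝ} :
    AEStronglyMeasurable (fun y : ℝ => (2 * u x - u (x + y) - u (x - y)) * y ^ (-1 - 2*s))
      (volume.restrict S) := by
  have h1 : Continuous (fun y => 2 * u x - u (x + y) - u (x - y)) := by fun_prop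
  have h2 : Measurable (fun y : ℝ => y ^ (-1 - 2*s)) := by fun_prop
  exact (h1.measurable.mul h2).aestronglyMeasurable

lemma layInt_near {s : ℝ} (hs : s ∈ Set.Ioo (0:ℝ) 1) {u : ℝ → ℝ} (hu : ContDiff ℝ 2 u) (x : ℝ) :
    IntegrableOn (fun y : ℝ => (2 * u x - u (x + y) - u (x - y)) * y ^ (-1 - 2*s)) (Ioc 0 1) := by
  have hu1 : ContDiff ℝ 1 (deriv u) := by
    have : ContDiff ℝ (1+1) u := by simpa [one_add_one_eq_two] using hu
    exact (contDiff_succ_iff_deriv.1 this).2.2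
  have hc : Continuous (deriv (deriv u)) := hu1.continuous_deriv (by norm_num)
  obtain ⟨B, hB⟩ := (isCompact_Icc (a := x - 1) (b := x + 1)).exists_bound_of_continuousOn
    hc.continuousOn
  refine Integrable.mono' ((int_near hs).const_mul (2 * B)) (meas_kernel hu.continuous x) ?_
  refine (ae_restrict_iff' measurableSet_Ioc).2 (ae_of_all _ fun y hy => ?_)
  have := secdiff hu (x := x) (y := y) (B := B) hy.1.le
    (fun z hz => hB z ⟨by linarith [hz.1, hy.2], by linarith [hz.2, hy.2]⟩)
  have hp : 0 ≤ y ^ (-1 - 2*s) := Real.rpow_nonneg hy.1.le _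
  rw [norm_mul, Real.norm_eq_abs, Real.norm_of_nonneg hp, ← sq_rpow hy.1, ← mul_assoc]
  exact mul_le_mul_of_nonneg_right this hp

lemma layInt_far {s : ℝ} (hs : s ∈ Set.Ioo (0:ℝ) 1) {u : ℝ → ℝ} (hu : Continuous u)
    (hb : ∃ M, ∀ x, |u x| ≤ M) (x : ℝ) :
    IntegrableOn (fun y : ℝ => (2 * u x - u (x + y) - u (x - y)) * y ^ (-1 - 2*s)) (Ioi 1) := by
  obtain ⟨M, hM⟩ := hb
  refine Integrable.mono' ((int_far hs).const_mul (4 * M)) (meas_kernel hu x) ?_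
  refine (ae_restrict_iff' measurableSet_Ioi).2 (ae_of_all _ fun y hy => ?_)
  have hp : 0 ≤ y ^ (-1 - 2*s) := Real.rpow_nonneg (le_trans zero_le_one (le_of_lt hy)) _
  rw [norm_mul, Real.norm_eq_abs, Real.norm_of_nonneg hp]
  refine mul_le_mul_of_nonneg_right ?_ hp
  have h1 := abs_le.1 (hM x)
  have h2 := abs_le.1 (hM (x+y))
  have h3 := abs_le.1 (hM (x-y))
  exact abs_le.2 ⟨by linarith [h1.1, h2.2, h3.2], by linarith [h1.2, h2.1, h3.1]⟩

lemma layInt {s : ℝ} (hs : s ∈ Set.Ioo (0:ℝ) 1) {u : ℝ → ℝ} (hu : ContDiff ℝ 2 u)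
    (hb : ∃ M, ∀ x, |u x| ≤ M) (x : ℝ) :
    IntegrableOn (fun y : ℝ => (2 * u x - u (x + y) - u (x - y)) * y ^ (-1 - 2*s)) (Ioi 0) := by
  have := (layInt_near hs hu x).union (layInt_far hs hu.continuous hb x)
  rwa [Ioc_union_Ioi_eq_Ioi zero_le_one] at this

lemma layJ_sub {s : ℝ} (hs : s ∈ Set.Ioo (0:ℝ) 1) {u w : ℝ → ℝ} (hu : ContDiff ℝ 2 u)
    (hb : ∃ M, ∀ x, |u x| ≤ M) (hw : ContDiff ℝ 2 w) (hbw : ∃ M, ∀ x, |w x| ≤ M) (x : ℝ) :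
    layJ s (fun x => u x - w x) x = layJ s u x - layJ s w x := by
  unfold layJ
  rw [← integral_sub (layInt hs hu hb x) (layInt hs hw hbw x)]
  congr 1; ext y; ring

lemma layJ_const_mul {s : ℝ} (c : ℝ) (u : ℝ → ℝ) (x : ℝ) :
    layJ s (fun x => c * u x) x = c * layJ s u x := by
  unfold layJ
  rw [← integral_const_mul]
  congr 1; ext y; ring

lemma layJ_shift {s : ℝ} (h : ℝ) (u : ℝ → ℝ) (x : ℝ) :
    layJ s (fun x => u (x + h)) x = layJ s u (x + h) := by
  unfold layJ
  congr 1; ext y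
  dsimp only
  rw [show x + y + h = x + h + y by ring, show x - y + h = x + h - y by ring]

lemma layJ_scale {s e : ℝ} (he : 0 < e) (u : ℝ → ℝ) (x : ℝ) :
    layJ s (fun x => u (e * x)) x = e ^ (2*s) * layJ s u (e * x) := by
  unfold layJ
  have h := integral_comp_mul_left_Ioi
    (fun z => (2 * u (e*x) - u (e*x + z) - u (e*x - z)) * z ^ (-1 - 2*s)) 0 he
  rw [mul_zero, smul_eq_mul] at h
  have hJ : (∫ z in Ioi (0:ℝ), (2 * u (e*x) - u (e*x + z) - u (e*x - z)) * z ^ (-1 - 2*s))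
      = e * ∫ y in Ioi (0:ℝ), (2 * u (e*x) - u (e*x + e*y) - u (e*x - e*y)) * (e*y) ^ (-1 - 2*s) := by
    rw [h]; field_simp
  rw [hJ, ← integral_const_mul, ← integral_const_mul]
  refine setIntegral_congr_fun measurableSet_Ioi fun y hy => ?_
  have hy0 : (0:ℝ) < y := hy
  simp only [mul_add, mul_sub]
  rw [Real.mul_rpow he.le hy0.le]
  have : e ^ (2*s) * (e * e ^ (-1 - 2*s)) = 1 := by
    nth_rewrite 2 [← Real.rpow_one e]
    rw [← Real.rpow_add he, ← Real.rpow_add he]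
    rw [show 2*s + (1 + (-1 - 2*s)) = 0 by ring, Real.rpow_zero]
  linear_combination (-(2 * u (e*x) - u (e*x + e*y) - u (e*x - e*y)) * y ^ (-1 - 2*s)) * this

lemma layg_pos (s x : ℝ) : 0 < layg s x := Real.rpow_pos_of_pos (by positivity) _

lemma layg_le_one {s : ℝ} (hs : s ∈ Set.Ioo (0:ℝ) 1) (x : ℝ) : layg s x ≤ 1 :=
  Real.rpow_le_one_of_one_le_of_nonpos (by nlinarith [sq_nonneg x]) (by linarith [hs.1])

lemma layg_abs_le {s : ℝ} (hs : s ∈ Set.Ioo (0:ℝ) 1) : ∃ M, ∀ x, |layg s x| ≤ M :=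
  ⟨1, fun x => by rw [abs_of_pos (layg_pos s x)]; exact layg_le_one hs x⟩

lemma rpow_comp {s : ℝ} (hs : s ∈ Set.Ioo (0:ℝ) 1) {a b k : ℝ} (ha : 0 < a) (hb : 0 < b)
    (hk : 1 ≤ k) (h : b ≤ k * a) :
    a ^ (-(1/2 + s)) ≤ k^2 * b ^ (-(1/2 + s)) := by
  have hk0 : 0 < k := by linarith
  have h1 : (k*a) ^ (-(1/2+s)) ≤ b ^ (-(1/2+s)) :=
    Real.rpow_le_rpow_of_nonpos hb h (by linarith [hs.1])
  rw [Real.mul_rpow hk0.le ha.le] at h1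
  have h2 : k ^ (1/2+s) ≤ k^2 := by
    rw [← Real.rpow_natCast]
    exact Real.rpow_le_rpow_of_exponent_le hk (by push_cast; linarith [hs.2])
  have h3 : k ^ (1/2+s) * k ^ (-(1/2+s)) = 1 := by
    rw [← Real.rpow_add hk0]; simp
  have h4 : 0 < b ^ (-(1/2+s)) := Real.rpow_pos_of_pos hb _
  have h5 : 0 < k ^ (1/2+s) := Real.rpow_pos_of_pos hk0 _
  calc a ^ (-(1/2+s)) = k ^ (1/2+s) * (k ^ (-(1/2+s)) * a ^ (-(1/2+s))) := by
        rw [← mul_assoc, h3, one_mul]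
    _ ≤ k ^ (1/2+s) * b ^ (-(1/2+s)) := mul_le_mul_of_nonneg_left h1 h5.le
    _ ≤ _ := mul_le_mul_of_nonneg_right h2 h4.le

lemma layg_comp {s : ℝ} (hs : s ∈ Set.Ioo (0:ℝ) 1) {a b k : ℝ}
    (hk : 1 ≤ k) (h : 1 + b^2 ≤ k * (1 + a^2)) : layg s a ≤ k^2 * layg s b :=
  rpow_comp hs (by positivity) (by positivity) hk h

lemma abs_rpow_eq {s x : ℝ} : |x| ^ (-1 - 2*s) = (x^2) ^ (-(1/2 + s)) := by
  rw [← sq_abs x, ← Real.rpow_natCast, ← Real.rpow_mul (abs_nonneg x)]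
  congr 1; push_cast; ring

lemma abs_rpow_le {s : ℝ} (hs : s ∈ Set.Ioo (0:ℝ) 1) {x : ℝ} (hx : 1 ≤ |x|) :
    |x| ^ (-1 - 2*s) ≤ 4 * layg s x := by
  have h1 : 1 ≤ x^2 := by rw [← sq_abs]; nlinarith
  rw [abs_rpow_eq]
  have := rpow_comp hs (a := x^2) (b := 1 + x^2) (k := 2) (by linarith) (by linarith)
    (by norm_num) (by linarith)
  unfold layg; linarith

lemma layg_le_abs {s : ℝ} (hs : s ∈ Set.Ioo (0:ℝ) 1) {x : ℝ} (hx : x ≠ 0) :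
    layg s x ≤ |x| ^ (-1 - 2*s) := by
  rw [abs_rpow_eq]
  exact Real.rpow_le_rpow_of_nonpos (by positivity) (by linarith) (by linarith [hs.1])

lemma layg_contDiff (s : ℝ) : ContDiff ℝ 2 (layg s) := by
  unfold layg
  exact ContDiff.rpow_const_of_ne (by fun_prop) (fun x => by positivity)

lemma layg_int {s : ℝ} (hs : s ∈ Set.Ioo (0:ℝ) 1) : Integrable (layg s) := by
  have := integrable_rpow_neg_one_add_norm_sq (E := ℝ) (μ := volume) (r := 1 + 2*s)
    (by simp; linarith [hs.1])
  refine this.congr (ae_of_all _ fun x => ?_)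
  simp only [layg, Real.norm_eq_abs, sq_abs]
  congr 1; ring

lemma layg_deriv (q x : ℝ) :
    HasDerivAt (fun x : ℝ => (1 + x^2) ^ q) (2 * q * (x * (1 + x^2) ^ (q - 1))) x := by
  have h1 : HasDerivAt (fun x : ℝ => 1 + x^2) (2 * x) x := by
    simpa using (hasDerivAt_pow 2 x).const_add 1
  have := h1.rpow_const (p := q) (Or.inl (by positivity))
  convert this using 1; ring

lemma layg_dd {s : ℝ} (hs : s ∈ Set.Ioo (0:ℝ) 1) (x : ℝ) :
    |deriv (deriv (layg s)) x| ≤ 18 * layg s x := by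
  set q := -(1/2 + s) with hq
  have e1 : deriv (layg s) = fun x => 2 * q * (x * (1 + x^2) ^ (q - 1)) := by
    ext x; exact (layg_deriv q x).deriv
  have e2 : HasDerivAt (fun x : ℝ => 2 * q * (x * (1 + x^2) ^ (q - 1)))
      (2 * q * (1 * (1 + x^2) ^ (q - 1) + x * (2 * (q - 1) * (x * (1 + x^2) ^ (q - 1 - 1))))) x :=
    ((hasDerivAt_id x).mul (layg_deriv (q-1) x)).const_mul _
  rw [e1, e2.deriv]
  have hp : 0 < 1 + x^2 := by positivity
  have hP : 0 < (1 + x^2) ^ (q - 1 - 1) := Real.rpow_pos_of_pos hp _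
  have f1 : (1 + x^2) ^ (q - 1) = (1 + x^2) * (1 + x^2) ^ (q - 1 - 1) := by
    rw [← Real.rpow_one_add' hp.le]
    · congr 1; ring
    · rw [hq]; intro h; linarith [hs.1]
  have f2 : layg s x = (1 + x^2)^2 * (1 + x^2) ^ (q - 1 - 1) := by
    unfold layg
    rw [← Real.rpow_natCast (1 + x^2), ← Real.rpow_add hp]
    congr 1; push_cast; ring
  rw [f1, f2]
  set P := (1 + x^2) ^ (q - 1 - 1)
  have hq1 : -3/2 ≤ q := by rw [hq]; linarith [hs.2]
  have hq2 : q ≤ 0 := by rw [hq]; linarith [hs.1]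
  have hx2 := sq_nonneg x
  have E : 2 * q * (1 * ((1 + x^2) * P) + x * (2 * (q - 1) * (x * P)))
      = (2 * q * (1 + x^2) + 4 * (q * (q-1)) * x^2) * P := by ring
  have b1 : 0 ≤ q * (q-1) := by nlinarith
  have b2 : q * (q-1) ≤ 15/4 := by nlinarith
  rw [E, abs_mul, abs_of_pos hP, ← mul_assoc (18:ℝ)]
  refine mul_le_mul_of_nonneg_right (abs_le.2 ⟨?_, ?_⟩) hP.le
  · nlinarith [mul_nonneg b1 hx2, mul_nonneg (sub_nonneg.2 hq1) hx2]
  · nlinarith [mul_nonneg (sub_nonneg.2 b2) hx2, mul_nonneg (sub_nonneg.2 hq2) hx2]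

lemma layg_conv {s : ℝ} (hs : s ∈ Set.Ioo (0:ℝ) 1) {a b x : ℝ} (h : |x| ≤ |a| + |b|) :
    layg s a * layg s b ≤ 16 * layg s x * (layg s a + layg s b) := by
  have hx := layg_pos s x
  have ha := layg_pos s a
  have hb := layg_pos s b
  have aux : ∀ z, |x| ≤ 2 * |z| → layg s z ≤ 16 * layg s x := by
    intro z hz
    have h1 : x^2 ≤ 4 * z^2 := by
      rw [← sq_abs x, ← sq_abs z]; nlinarith [abs_nonneg x, abs_nonneg z]
    have := layg_comp hs (a := z) (b := x) (k := 4) (by norm_num) (by linarith)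
    linarith
  rcases le_total |a| |b| with hab | hab
  · have := aux b (by linarith)
    nlinarith [mul_pos hx hb, mul_le_mul_of_nonneg_left this ha.le]
  · have := aux a (by linarith)
    nlinarith [mul_pos hx ha, mul_le_mul_of_nonneg_right this hb.le]

lemma layJ_g {s : ℝ} (hs : s ∈ Set.Ioo (0:ℝ) 1) :
    ∃ C : ℝ, 0 < C ∧ ∀ x, |layJ s (layg s) x| ≤ C * layg s x := by
  set A := ∫ y in Ioc (0:ℝ) 1, y ^ (1 - 2*s) with hA
  set B := ∫ y in Ioi (1:ℝ), y ^ (-1 - 2*s) with hB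
  set I := ∫ y, layg s y with hI
  have hgint := layg_int hs
  have hgpos := layg_pos s
  have hA0 : 0 ≤ A := setIntegral_nonneg measurableSet_Ioc fun y hy => Real.rpow_nonneg hy.1.le _
  have hB0 : 0 ≤ B := setIntegral_nonneg measurableSet_Ioi fun y hy =>
    Real.rpow_nonneg (le_trans zero_le_one (le_of_lt hy)) _
  have hI0 : 0 ≤ I := integral_nonneg fun y => (hgpos y).le
  refine ⟨324 * A + (2 * B + 256 * I) + 1, by positivity, fun x => ?_⟩
  have hsplit : layJ s (layg s) x =
      (∫ y in Ioc (0:ℝ) 1, (2 * layg s x - layg s (x + y) - layg s (x - y)) * y ^ (-1 - 2*s))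
      + ∫ y in Ioi (1:ℝ), (2 * layg s x - layg s (x + y) - layg s (x - y)) * y ^ (-1 - 2*s) := by
    unfold layJ
    rw [← Ioc_union_Ioi_eq_Ioi (zero_le_one (α := ℝ))]
    exact setIntegral_union (Ioc_disjoint_Ioi le_rfl) measurableSet_Ioi
      (layInt_near hs (layg_contDiff s) x)
      (layInt_far hs (layg_contDiff s).continuous (layg_abs_le hs) x)
  have hnear : |∫ y in Ioc (0:ℝ) 1, (2 * layg s x - layg s (x + y) - layg s (x - y)) * y ^ (-1 - 2*s)|
      ≤ 324 * layg s x * A := by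
    rw [hA, ← integral_const_mul, ← Real.norm_eq_abs]
    refine norm_integral_le_of_norm_le ((int_near hs).const_mul _) ?_
    refine (ae_restrict_iff' measurableSet_Ioc).2 (ae_of_all _ fun y hy => ?_)
    have := secdiff (layg_contDiff s) (x := x) (y := y) (B := 162 * layg s x) hy.1.le
      (fun z hz => by
        refine (layg_dd hs z).trans ?_
        have h1 : (x - z)^2 ≤ 1 := by
          have := hz.1; have := hz.2; have := hy.2
          rw [sq_le_one_iff_abs_le_one]
          exact abs_le.2 ⟨by linarith, by linarith⟩
        have := layg_comp hs (a := z) (b := x) (k := 3) (by norm_num)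
          (by nlinarith [sq_nonneg (x - 2*z)])
        linarith)
    have hp : 0 ≤ y ^ (-1 - 2*s) := Real.rpow_nonneg hy.1.le _
    rw [norm_mul, Real.norm_eq_abs, Real.norm_of_nonneg hp, ← sq_rpow hy.1, ← mul_assoc]
    refine mul_le_mul_of_nonneg_right (this.trans (le_of_eq (by ring))) hp
  have i1 : Integrable (fun y => layg s (x + y)) := hgint.comp_add_left x
  have i2 : Integrable (fun y => layg s (x - y)) := hgint.comp_sub_left x
  have hfar : |∫ y in Ioi (1:ℝ), (2 * layg s x - layg s (x + y) - layg s (x - y)) * y ^ (-1 - 2*s)|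
      ≤ layg s x * (2 * B + 256 * I) := by
    have hle : |∫ y in Ioi (1:ℝ), (2 * layg s x - layg s (x + y) - layg s (x - y)) * y ^ (-1 - 2*s)|
        ≤ ∫ y in Ioi (1:ℝ), layg s x * (2 * y ^ (-1 - 2*s)
          + 64 * (layg s (x + y) + layg s (x - y) + 2 * layg s y)) := by
      rw [← Real.norm_eq_abs]
      refine norm_integral_le_of_norm_le ?_ ?_
      · exact (((int_far hs).const_mul 2).add
          (((i1.add i2).add (hgint.const_mul 2)).const_mul 64).integrableOn).const_mul _
      refine (ae_restrict_iff' measurableSet_Ioi).2 (ae_of_all _ fun y hy => ?_)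
      have hy1 : (1:ℝ) < y := hy
      have hy0 : 0 ≤ y := by linarith
      have hp : 0 ≤ y ^ (-1 - 2*s) := Real.rpow_nonneg hy0 _
      have hp4 : y ^ (-1 - 2*s) ≤ 4 * layg s y := by
        have := abs_rpow_le hs (x := y) (by rw [abs_of_nonneg hy0]; exact hy1.le)
        rwa [abs_of_nonneg hy0] at this
      rw [norm_mul, Real.norm_eq_abs, Real.norm_of_nonneg hp]
      have c1 := layg_conv hs (a := x + y) (b := y) (x := x)
        (by have := abs_sub (x + y) y; rwa [add_sub_cancel_right] at this)
      have c2 := layg_conv hs (a := x - y) (b := y) (x := x)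
        (by have := abs_add_le (x - y) y; rwa [sub_add_cancel] at this)
      have g0 := hgpos x
      have g1 := hgpos (x + y)
      have g2 := hgpos (x - y)
      have hD : |2 * layg s x - layg s (x + y) - layg s (x - y)|
          ≤ 2 * layg s x + layg s (x + y) + layg s (x - y) :=
        abs_le.2 ⟨by linarith, by linarith⟩
      have d1 := mul_le_mul_of_nonneg_left hp4 g1.le
      have d2 := mul_le_mul_of_nonneg_left hp4 g2.le
      have d3 := mul_le_mul_of_nonneg_right hD hp
      nlinarith
    refine hle.trans ?_
    rw [integral_const_mul]
    refine mul_le_mul_of_nonneg_left ?_ (hgpos x).le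
    have e5 : ∫ y in Ioi (1:ℝ), (2 * y ^ (-1 - 2*s)
          + 64 * (layg s (x + y) + layg s (x - y) + 2 * layg s y))
        = (∫ y in Ioi (1:ℝ), 2 * y ^ (-1 - 2*s))
          + ∫ y in Ioi (1:ℝ), 64 * (layg s (x + y) + layg s (x - y) + 2 * layg s y) :=
      integral_add ((int_far hs).const_mul 2)
        (((i1.add i2).add (hgint.const_mul 2)).const_mul 64).integrableOn
    rw [e5, integral_const_mul, integral_const_mul]
    have hK : ∫ y in Ioi (1:ℝ), (layg s (x + y) + layg s (x - y) + 2 * layg s y) ≤ 4 * I := by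
      refine (setIntegral_le_integral ((i1.add i2).add (hgint.const_mul 2))
        (ae_of_all _ fun y => ?_)).trans (le_of_eq ?_)
      · have g1 := hgpos (x + y)
        have g2 := hgpos (x - y)
        have g3 := hgpos y
        simp only [Pi.zero_apply, Pi.add_apply]; positivity
      · have e0 := integral_add (i1.add i2) (hgint.const_mul 2)
        have e1 := integral_add i1 i2
        have e2 : ∫ y, layg s (x + y) = I := integral_add_left_eq_self (layg s) x
        have e3 : ∫ y, layg s (x - y) = I := integral_sub_left_eq_self (layg s) volume x
        have e4 : ∫ y, 2 * layg s y = 2 * I := integral_const_mul _ _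
        simp only [Pi.add_apply] at e0 ⊢
        rw [e0, e1, e2, e3, e4]; ring
    linarith
  rw [hsplit]
  refine (abs_add_le _ _).trans ?_
  nlinarith [hgpos x]

lemma cocompact_min {u : ℝ → ℝ} (hu : Continuous u) (ht : Tendsto u (cocompact ℝ) (nhds 0))
    {x1 : ℝ} (h : u x1 < 0) : ∃ x0, u x0 < 0 ∧ ∀ y, u x0 ≤ u y := by
  obtain ⟨x0, h0⟩ := hu.exists_forall_le' x1 ((ht.eventually (lt_mem_nhds h)).mono fun _ h => h.le)
  exact ⟨x0, (h0 x1).trans_lt h, h0⟩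

lemma layg_tendsto {s : ℝ} (hs : s ∈ Set.Ioo (0:ℝ) 1) :
    Tendsto (layg s) (cocompact ℝ) (nhds 0) := by
  have h1 : Tendsto (fun x : ℝ => |x|) (cocompact ℝ) atTop :=
    tendsto_norm_cocompact_atTop (E := ℝ)
  have h2 : Tendsto (fun t : ℝ => t ^ (-(1 + 2*s))) atTop (nhds 0) :=
    tendsto_rpow_neg_atTop (by linarith [hs.1])
  refine squeeze_zero' (Eventually.of_forall fun x => (layg_pos s x).le) ?_ (h2.comp h1)
  filter_upwards [h1.eventually_ge_atTop 1] with x hx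
  have hx0 : x ≠ 0 := by rintro rfl; norm_num at hx
  have := layg_le_abs hs hx0
  rwa [show -1 - 2*s = -(1 + 2*s) by ring] at this

lemma upper_lemma {s : ℝ} (hs : s ∈ Set.Ioo (0:ℝ) 1) {l R : ℝ} (hl : 0 < l) :
    ∃ e K : ℝ, 0 < e ∧ 0 < K ∧ ∀ (w : ℝ → ℝ) (A : ℝ), 0 < A → ContDiff ℝ 2 w →
      (∃ M, ∀ x, |w x| ≤ M) → Tendsto w (cocompact ℝ) (nhds 0) →
      (∀ x, R ≤ |x| → layJ s w x ≤ - l * w x) → (∀ x, |x| ≤ R → w x ≤ A) →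
      ∀ x, w x ≤ A * K * layg s (e * x) := by
  obtain ⟨C, hC, hJ⟩ := layJ_g hs
  set e := (l / (2 * C)) ^ (1 / (2*s)) with he
  have hs0 := hs.1
  have he0 : 0 < e := Real.rpow_pos_of_pos (by positivity) _
  have hes : e ^ (2*s) = l / (2 * C) := by
    rw [he, ← Real.rpow_mul (by positivity)]
    rw [show 1 / (2*s) * (2*s) = 1 by field_simp, Real.rpow_one]
  have hgR := layg_pos s (e * R)
  refine ⟨e, 1 / layg s (e * R), he0, by positivity, ?_⟩
  intro w A hA hw hbw htw hLw hin
  set k := A * (1 / layg s (e * R)) with hk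
  have hk0 : 0 < k := by positivity
  by_contra! hcon
  obtain ⟨x1, hx1⟩ := hcon
  set φ : ℝ → ℝ := fun x => k * layg s (e * x) with hφ
  have hφc : ContDiff ℝ 2 φ := contDiff_const.mul ((layg_contDiff s).comp (by fun_prop))
  have hφb : ∃ M, ∀ x, |φ x| ≤ M := by
    refine ⟨k, fun x => ?_⟩
    have := layg_pos s (e * x)
    rw [abs_of_pos (by positivity)]
    have := layg_le_one hs (e * x)
    simp only [hφ]; nlinarith
  have hφt : Tendsto φ (cocompact ℝ) (nhds 0) := by
    have h1 : Tendsto (fun x : ℝ => e * x) (cocompact ℝ) (cocompact ℝ) :=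
      (Homeomorph.mulLeft₀ e he0.ne').isClosedEmbedding.tendsto_cocompact
    simpa using ((layg_tendsto hs).comp h1).const_mul k
  have hut : Tendsto (fun x => φ x - w x) (cocompact ℝ) (nhds 0) := by
    simpa using hφt.sub htw
  obtain ⟨x0, hneg, hmin⟩ := cocompact_min (hφc.continuous.sub hw.continuous) hut
    (x1 := x1) (by simp only [Pi.sub_apply, hφ]; linarith)
  simp only [Pi.sub_apply] at hneg hmin
  have hxR : R ≤ |x0| := by
    by_contra! hlt
    have h1 := hin x0 hlt.le
    have h2 : layg s (e * R) ≤ layg s (e * x0) := by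
      have : x0^2 ≤ R^2 := by rw [← sq_abs x0]; nlinarith [abs_nonneg x0]
      have := layg_comp hs (a := e * x0) (b := e * R) (k := 1) le_rfl
      refine Real.rpow_le_rpow_of_nonpos (by positivity) ?_ (by linarith)
      have e2 : 0 < e^2 := by positivity
      nlinarith
    have h3 : A = k * layg s (e * R) := by rw [hk]; field_simp
    have h4 := mul_le_mul_of_nonneg_left h2 hk0.le
    simp only [hφ] at hneg; linarith
  have hL1 : layJ s (fun x => φ x - w x) x0 ≤ 0 := by
    unfold layJ
    refine setIntegral_nonpos measurableSet_Ioi fun y hy => ?_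
    have hp : 0 ≤ y ^ (-1 - 2*s) := Real.rpow_nonneg (le_of_lt hy) _
    have h1 := hmin (x0 + y)
    have h2 := hmin (x0 - y)
    exact mul_nonpos_of_nonpos_of_nonneg (by dsimp only; linarith) hp
  rw [layJ_sub hs hφc hφb hw hbw] at hL1
  have hφJ : layJ s φ x0 = k * (l / (2*C) * layJ s (layg s) (e * x0)) := by
    rw [hφ, layJ_const_mul, layJ_scale he0, hes]
  have h5 := hLw x0 hxR
  have h6 := (abs_le.1 (hJ (e * x0))).1
  have h7 : - (l / 2) * φ x0 ≤ layJ s φ x0 := by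
    rw [hφJ]
    have := mul_le_mul_of_nonneg_left h6 (show 0 ≤ k * (l / (2*C)) by positivity)
    have e1 : k * (l / (2*C)) * -(C * layg s (e * x0)) = - (l/2) * φ x0 := by
      simp only [hφ]; field_simp
    rw [e1] at this; linarith
  have h8 : 0 < φ x0 := mul_pos hk0 (layg_pos _ _)
  nlinarith

lemma lower_lemma {s : ℝ} (hs : s ∈ Set.Ioo (0:ℝ) 1) {L R : ℝ} (hL : 0 < L) (hR : 1 ≤ R) :
    ∃ c : ℝ, 0 < c ∧ ∀ (w : ℝ → ℝ) (m : ℝ), 0 < m → ContDiff ℝ 2 w →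
      (∃ M, ∀ x, |w x| ≤ M) → Tendsto w (cocompact ℝ) (nhds 0) →
      (∀ x, R ≤ |x| → - L * w x ≤ layJ s w x) → (∀ x, |x| ≤ R → m ≤ w x) →
      ∀ x, m * c * layg s x ≤ w x := by
  obtain ⟨C, hC, hJ⟩ := layJ_g hs
  have hs0 := hs.1
  refine ⟨1 / (4 * (L + C + 1)), by positivity, ?_⟩
  set c := 1 / (4 * (L + C + 1)) with hc
  have hc0 : 0 < c := by positivity
  have hcL : c * (L + C + 1) = 1/4 := by rw [hc]; field_simp
  have hc1 : c ≤ 1/4 := by nlinarith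
  intro w m hm hw hbw htw hLw hin
  by_contra! hcon
  obtain ⟨x1, hx1⟩ := hcon
  set φ : ℝ → ℝ := fun x => (m * c) * layg s x with hφ
  have hmc : 0 < m * c := by positivity
  have hφc : ContDiff ℝ 2 φ := contDiff_const.mul (layg_contDiff s)
  have hφle : ∀ x, φ x ≤ m / 4 := by
    intro x
    have h1 := layg_le_one hs x
    simp only [hφ]; nlinarith
  have hφb : ∃ M, ∀ x, |φ x| ≤ M := by
    refine ⟨m / 4, fun x => ?_⟩
    rw [abs_of_pos (mul_pos hmc (layg_pos _ _))]; exact hφle x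
  have hφt : Tendsto φ (cocompact ℝ) (nhds 0) := by
    simpa using (layg_tendsto hs).const_mul (m * c)
  have hut : Tendsto (fun x => w x - φ x) (cocompact ℝ) (nhds 0) := by
    simpa using htw.sub hφt
  obtain ⟨x0, hneg, hmin⟩ := cocompact_min (hw.continuous.sub hφc.continuous) hut
    (x1 := x1) (by simp only [Pi.sub_apply, hφ]; linarith)
  simp only [Pi.sub_apply] at hneg hmin
  have hxR : R < |x0| := by
    by_contra! hle
    have h1 := hin x0 hle
    have := hφle x0
    linarith
  have hx0 : x0 ≠ 0 := by rintro rfl; simp at hxR; linarith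
  have hint := layInt hs (hw.sub hφc) (x := x0) (by
    obtain ⟨M1, h1⟩ := hbw
    obtain ⟨M2, h2⟩ := hφb
    refine ⟨M1 + M2, fun x => (abs_sub _ _).trans (add_le_add (h1 x) (h2 x))⟩)
  have hL1 : layJ s (fun x => w x - φ x) x0 ≤ -(m/2) * |x0| ^ (-1 - 2*s) := by
    have hP : ∀ y ∈ Ioi (0:ℝ), 0 ≤ -((2 * (w x0 - φ x0) - (w (x0 + y) - φ (x0 + y))
        - (w (x0 - y) - φ (x0 - y))) * y ^ (-1 - 2*s)) := by
      intro y hy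
      have hp : 0 ≤ y ^ (-1 - 2*s) := Real.rpow_nonneg (le_of_lt hy) _
      have h1 := hmin (x0 + y)
      have h2 := hmin (x0 - y)
      rw [neg_nonneg]
      exact mul_nonpos_of_nonpos_of_nonneg (by linarith) hp
    have hsub : Ioc (|x0| - 1) |x0| ⊆ Ioi (0:ℝ) := fun y hy => by
      have := hy.1; simp only [mem_Ioi]; linarith
    have h1 := setIntegral_mono_set hint.neg
      ((ae_restrict_iff' measurableSet_Ioi).2 (ae_of_all _ hP)) hsub.eventuallyLE
    have h2 : ∫ y in Ioc (|x0| - 1) |x0|, (m/2) * |x0| ^ (-1 - 2*s) ≤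
        ∫ y in Ioc (|x0| - 1) |x0|, -((2 * (w x0 - φ x0) - (w (x0 + y) - φ (x0 + y))
        - (w (x0 - y) - φ (x0 - y))) * y ^ (-1 - 2*s)) := by
      refine setIntegral_mono_on continuous_const.integrableOn_Ioc (hint.neg.mono_set hsub) measurableSet_Ioc fun y hy => ?_
      have hy0 : 0 < y := hsub hy
      have hp : |x0| ^ (-1 - 2*s) ≤ y ^ (-1 - 2*s) :=
        Real.rpow_le_rpow_of_nonpos hy0 hy.2 (by linarith)
      have hp0 : 0 ≤ |x0| ^ (-1 - 2*s) := Real.rpow_nonneg (abs_nonneg _) _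
      have q1 := hmin (x0 + y)
      have q2 := hmin (x0 - y)
      have hin' : ∀ z, |z| ≤ 1 → m/2 ≤ w z - φ z := fun z hz => by
        have := hin z (hz.trans hR)
        have := hφle z
        linarith
      have hkey : m/2 ≤ -(2 * (w x0 - φ x0) - (w (x0 + y) - φ (x0 + y))
        - (w (x0 - y) - φ (x0 - y))) := by
        rcases le_total 0 x0 with h | h
        · rw [abs_of_nonneg h] at hy
          have := hin' (x0 - y) (abs_le.2 ⟨by linarith [hy.2], by linarith [hy.1]⟩)
          linarith
        · rw [abs_of_nonpos h] at hy
          have := hin' (x0 + y) (abs_le.2 ⟨by linarith [hy.1], by linarith [hy.2]⟩)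
          linarith
      rw [← neg_mul]
      exact mul_le_mul hkey hp hp0 (by linarith)
    have h3 : ∫ y in Ioc (|x0| - 1) |x0|, (m/2) * |x0| ^ (-1 - 2*s) = (m/2) * |x0| ^ (-1 - 2*s) := by
      simp
    have h4 := (h3.symm.le.trans h2).trans h1
    simp only [Pi.neg_apply] at h4
    rw [integral_neg] at h4
    unfold layJ; linarith
  rw [layJ_sub hs hw hbw hφc hφb] at hL1
  have hφJ : layJ s φ x0 = (m * c) * layJ s (layg s) x0 := by
    rw [hφ, layJ_const_mul]
  have h5 := hLw x0 hxR.le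
  have h6 := (abs_le.1 (hJ x0)).2
  have h7 : layJ s φ x0 ≤ C * φ x0 := by
    rw [hφJ]
    have := mul_le_mul_of_nonneg_left h6 hmc.le
    simp only [hφ]; linarith
  have h9 := layg_le_abs hs hx0
  have h10 : φ x0 * (L + C + 1) = m / 4 * layg s x0 := by
    simp only [hφ]; linear_combination (m * layg s x0) * hcL
  have h11 := mul_le_mul_of_nonneg_left h9 (show 0 ≤ m/2 by positivity)
  have h12 := mul_le_mul_of_nonneg_left (show w x0 ≤ φ x0 by linarith) hL.le
  have h13 : 0 < φ x0 := mul_pos hmc (layg_pos _ _)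
  have h14 := mul_pos hm (layg_pos s x0)
  linarith

lemma near_zero {f : ℝ → ℝ} (hf : ContDiff ℝ 1 f) {a : ℝ} (ha : deriv f a < 0) :
    ∃ d : ℝ, 0 < d ∧ ∀ p ∈ Metric.ball a d, ∀ q ∈ Metric.ball a d, p < q →
      f q - f p ≤ deriv f a / 2 * (q - p) ∧ 2 * deriv f a * (q - p) ≤ f q - f p := by
  have hc : Continuous (deriv f) := hf.continuous_deriv le_rfl
  have hn : ∀ᶠ r in nhds a, deriv f r ∈ Ioo (2 * deriv f a) (deriv f a / 2) :=
    hc.continuousAt.eventually (Ioo_mem_nhds (by linarith) (by linarith))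
  obtain ⟨d, hd, hball⟩ := Metric.eventually_nhds_iff_ball.1 hn
  refine ⟨d, hd, fun p hp q hq hpq => ?_⟩
  obtain ⟨r, hr, hr'⟩ := exists_deriv_eq_slope f hpq hf.continuous.continuousOn
    (hf.differentiable (by norm_num)).differentiableOn
  have hrb : r ∈ Metric.ball a d := by
    rw [Real.ball_eq_Ioo] at hp hq ⊢
    exact ⟨hp.1.trans hr.1, hr.2.trans hq.2⟩
  have h := hball r hrb
  have hpos : 0 < q - p := by linarith
  have e : f q - f p = deriv f r * (q - p) := by rw [hr']; field_simp
  rw [e]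
  exact ⟨mul_le_mul_of_nonneg_right h.2.le hpos.le, mul_le_mul_of_nonneg_right h.1.le hpos.le⟩

/-- Asymptotic behavior of the derivative of a layer solution. -/
theorem statement4 (s γ : ℝ) (hs : s ∈ Set.Ioo (0:ℝ) 1)
    (hγ : max 0 (1 - 2*s) < γ)
    (f : ℝ → ℝ) (hf : IsC1Holder γ f)
    (hfm : deriv f (-1) < 0) (hfp : deriv f 1 < 0)
    (v : ℝ → ℝ) (hv : IsLayerSolution s f v) :
    ∃ c C : ℝ, 0 < c ∧ c ≤ C ∧
      ∀ x : ℝ, 1 ≤ |x| →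
        c * |x| ^ (-1 - 2*s) ≤ deriv v x ∧ deriv v x ≤ C * |x| ^ (-1 - 2*s) := by
  obtain ⟨d1, hd1, hf1⟩ := near_zero hf.1 hfp
  obtain ⟨d2, hd2, hf2⟩ := near_zero hf.1 hfm
  obtain ⟨R1, hR1⟩ := eventually_atTop.1 (hv.limPos.eventually (Metric.ball_mem_nhds 1 hd1))
  obtain ⟨R2, hR2⟩ := eventually_atBot.1 (hv.limNeg.eventually (Metric.ball_mem_nhds (-1) hd2))
  set R := max 1 (max R1 (1 - R2)) with hR
  have hRa : 1 ≤ R := le_max_left _ _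
  have hRb : R1 ≤ R := (le_max_left _ _).trans (le_max_right _ _)
  have hRc : 1 - R2 ≤ R := (le_max_right _ _).trans (le_max_right _ _)
  set κ := fracLapCoef s with hκ
  have hκ0 : 0 < κ := coef_pos hs
  have hvd : Differentiable ℝ v := hv.smooth.differentiable (by norm_num)
  have hvmono : StrictMono v := strictMono_of_deriv_pos hv.mono
  have hvJ : ∀ x, layJ s v x = f (v x) / κ := fun x => by
    rw [← hv.eqn x, fracLap]
    change layJ s v x = κ * layJ s v x / κ
    field_simp
  set l := min (-deriv f 1 / 2) (-deriv f (-1) / 2) with hl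
  set L := max (-2 * deriv f 1) (-2 * deriv f (-1)) with hL
  have hl0 : 0 < l := lt_min (by linarith) (by linarith)
  have hL0 : 0 < L := lt_max_of_lt_left (by linarith)
  have hl1 : l ≤ -deriv f 1 / 2 := min_le_left _ _
  have hl2 : l ≤ -deriv f (-1) / 2 := min_le_right _ _
  have hL1 : -2 * deriv f 1 ≤ L := le_max_left _ _
  have hL2 : -2 * deriv f (-1) ≤ L := le_max_right _ _
  -- bounds of the derivative on a compact interval
  have hdc : Continuous (deriv v) := hv.smooth.continuous_deriv (by norm_num)
  have hne : (Icc (-R) (R + 1)).Nonempty := ⟨0, by linarith, by linarith⟩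
  obtain ⟨z1, -, hz1⟩ := isCompact_Icc.exists_isMinOn hne hdc.continuousOn
  obtain ⟨z2, -, hz2⟩ := isCompact_Icc.exists_isMaxOn hne hdc.continuousOn
  set m := deriv v z1 with hm
  set A := deriv v z2 with hA
  have hm0 : 0 < m := hv.mono z1
  have hA0 : 0 < A := hv.mono z2
  obtain ⟨e, K, he, hK, hup⟩ := upper_lemma hs (l := l / κ) (R := R) (by positivity)
  obtain ⟨c, hc, hlow⟩ := lower_lemma hs (L := L / κ) (R := R) (by positivity) hRa
  -- increments
  have main : ∀ h, 0 < h → h ≤ 1 → ∀ x,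
      (m * h) * c * layg s x ≤ v (x + h) - v x ∧
      v (x + h) - v x ≤ (A * h) * K * layg s (e * x) := by
    intro h h0 h1
    have hshift : ContDiff ℝ 2 (fun x => v (x + h)) := hv.smooth.comp (by fun_prop)
    have hshiftb : ∃ M, ∀ x, |v (x + h)| ≤ M := by
      obtain ⟨M, hM⟩ := hv.bounded
      exact ⟨M, fun x => hM _⟩
    have hw : ContDiff ℝ 2 (fun x => v (x + h) - v x) := hshift.sub hv.smooth
    have hwb : ∃ M, ∀ x, |v (x + h) - v x| ≤ M := by
      obtain ⟨M, hM⟩ := hv.bounded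
      exact ⟨M + M, fun x => (abs_sub _ _).trans (add_le_add (hM _) (hM _))⟩
    have hwt : Tendsto (fun x => v (x + h) - v x) (cocompact ℝ) (nhds 0) := by
      rw [cocompact_eq_atBot_atTop, tendsto_sup]
      constructor
      · simpa using (hv.limNeg.comp (tendsto_atBot_add_const_right _ h tendsto_id)).sub hv.limNeg
      · simpa using (hv.limPos.comp (tendsto_atTop_add_const_right _ h tendsto_id)).sub hv.limPos
    have hJ : ∀ x, layJ s (fun x => v (x + h) - v x) x = (f (v (x + h)) - f (v x)) / κ := by
      intro x
      rw [layJ_sub hs hshift hshiftb hv.smooth hv.bounded, layJ_shift, hvJ, hvJ]; ring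
    have hbd : ∀ x, R ≤ |x| → f (v (x + h)) - f (v x) ≤ -l * (v (x + h) - v x) ∧
        -L * (v (x + h) - v x) ≤ f (v (x + h)) - f (v x) := by
      intro x hx
      have hlt : v x < v (x + h) := hvmono (by linarith)
      have hpos : 0 < v (x + h) - v x := by linarith
      rcases le_total 0 x with hx0 | hx0
      · rw [abs_of_nonneg hx0] at hx
        have := hf1 _ (hR1 x (by linarith)) _ (hR1 (x + h) (by linarith)) hlt
        constructor <;> nlinarith
      · rw [abs_of_nonpos hx0] at hx
        have := hf2 _ (hR2 x (by linarith)) _ (hR2 (x + h) (by linarith)) hlt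
        constructor <;> nlinarith
    have hmv : ∀ x, |x| ≤ R → m * h ≤ v (x + h) - v x ∧ v (x + h) - v x ≤ A * h := by
      intro x hx
      have hx' := abs_le.1 hx
      obtain ⟨r, hr, hr'⟩ := exists_deriv_eq_slope v (show x < x + h by linarith)
        hv.smooth.continuous.continuousOn hvd.differentiableOn
      rw [add_sub_cancel_left, eq_div_iff h0.ne'] at hr'
      have hrI : r ∈ Icc (-R) (R + 1) := ⟨by linarith [hr.1, hx'.1], by linarith [hr.2, hx'.2]⟩
      have a1 : m ≤ deriv v r := hz1 hrI
      have a2 : deriv v r ≤ A := hz2 hrI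
      rw [← hr']
      exact ⟨mul_le_mul_of_nonneg_right a1 h0.le, mul_le_mul_of_nonneg_right a2 h0.le⟩
    intro x
    refine ⟨hlow _ (m * h) (by positivity) hw hwb hwt ?_ (fun x hx => (hmv x hx).1) x,
      hup _ (A * h) (by positivity) hw hwb hwt ?_ (fun x hx => (hmv x hx).2) x⟩
    · intro x hx
      rw [hJ, le_div_iff₀ hκ0]
      have := (hbd x hx).2
      calc _ = -L * (v (x + h) - v x) := by field_simp
        _ ≤ _ := this
    · intro x hx
      rw [hJ, div_le_iff₀ hκ0]
      have := (hbd x hx).1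
      calc _ ≤ -l * (v (x + h) - v x) := this
        _ = _ := by field_simp
  have hder : ∀ x, m * c * layg s x ≤ deriv v x ∧ deriv v x ≤ A * K * layg s (e * x) := by
    intro x
    have ht := (hvd x).hasDerivAt.tendsto_slope_zero_right
    have hev : ∀ᶠ t in nhdsWithin (0:ℝ) (Ioi 0), t ∈ Ioc (0:ℝ) 1 := Ioc_mem_nhdsGT one_pos
    constructor
    · refine ge_of_tendsto ht (hev.mono fun t ht => ?_)
      have := (main t ht.1 ht.2 x).1
      have h0 := ht.1
      rw [smul_eq_mul, inv_mul_eq_div, le_div_iff₀ h0]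
      linarith
    · refine le_of_tendsto ht (hev.mono fun t ht => ?_)
      have := (main t ht.1 ht.2 x).2
      have h0 := ht.1
      rw [smul_eq_mul, inv_mul_eq_div, div_le_iff₀ h0]
      linarith
  refine ⟨m * c / 4, max (m * c / 4) (A * K * e ^ (-1 - 2*s)), by positivity, le_max_left _ _, ?_⟩
  intro x hx
  have hx0 : x ≠ 0 := by rintro rfl; norm_num at hx
  have hp0 : 0 ≤ |x| ^ (-1 - 2*s) := Real.rpow_nonneg (abs_nonneg _) _
  obtain ⟨b1, b2⟩ := hder x
  constructor
  · have := mul_le_mul_of_nonneg_left (abs_rpow_le hs hx) (show 0 ≤ m * c / 4 by positivity)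
    linarith
  · have h1 := layg_le_abs hs (mul_ne_zero he.ne' hx0)
    rw [abs_mul, abs_of_pos he, Real.mul_rpow he.le (abs_nonneg x)] at h1
    have h2 := mul_le_mul_of_nonneg_left h1 (show 0 ≤ A * K by positivity)
    have h3 := mul_le_mul_of_nonneg_right
      (le_max_right (m * c / 4) (A * K * e ^ (-1 - 2*s))) hp0
    linarith
end

section
/- Let s ∈ (0,1) and t > 0. Then p_s(t,x) > 0 for every x ∈ ℝ; consequently the function v^t_s is strictly increasing on ℝ, with (v^t_s)′(x) = 2 p_s(t,x), and it satisfies lim_{x→−∞} v^t_s(x) = −1 and lim_{x→+∞} v^t_s(x) = 1. -/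
open Real MeasureTheory Filter Set

/-- The fundamental solution `p_s(t,x)` of the fractional heat equation. -/
noncomputable def fracHeatKernel (s t x : ℝ) : ℝ :=
  (1/π) * ∫ r in Set.Ioi (0:ℝ), Real.cos (x*r) * Real.exp (-(t * r ^ (2*s)))

/-- The explicit layer solution `v^t_s`. -/
noncomputable def layerV (s t : ℝ) (x : ℝ) : ℝ :=
  (2/π) * ∫ r in Set.Ioi (0:ℝ), (Real.sin (x*r) / r) * Real.exp (-(t * r ^ (2*s)))


namespace FHK

/-- Regularised symbol. -/
noncomputable def E (a d t r : ℝ) : ℝ := Real.exp (-(t * r ^ a + d * r))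

/-- Regularised (unnormalised) kernel. -/
noncomputable def U (a d t x : ℝ) : ℝ := ∫ r in Ioi (0:ℝ), Real.cos (x*r) * E a d t r

lemma E_pos (a d t r : ℝ) : 0 < E a d t r := Real.exp_pos _

lemma E_meas (a d t : ℝ) : Measurable (E a d t) := by
  unfold E; fun_prop

lemma E_meas2 (a d : ℝ) (t : ℝ) : Measurable (fun p : ℝ × ℝ => E a d t p.1) :=
  (E_meas a d t).comp measurable_fst

lemma intA {a d t k : ℝ} (ha : 0 < a) (hd : 0 ≤ d) (ht : 0 < t) (hk : -1 < k) :
    IntegrableOn (fun r => r ^ k * E a d t r) (Ioi 0) := by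
  refine (integrableOn_rpow_mul_exp_neg_mul_rpow hk ha ht).mono' ?_ ?_
  · exact ((measurable_id.pow_const k).mul (E_meas a d t)).aestronglyMeasurable
  · refine ae_restrict_of_forall_mem measurableSet_Ioi fun r hr => ?_
    have hr : 0 < r := hr
    rw [norm_mul, Real.norm_of_nonneg (rpow_nonneg hr.le k), Real.norm_of_nonneg (E_pos ..).le]
    refine mul_le_mul_of_nonneg_left ?_ (rpow_nonneg hr.le k)
    unfold E
    refine Real.exp_le_exp.2 ?_
    nlinarith [mul_nonneg hd hr.le]

lemma intA0 {a d t : ℝ} (ha : 0 < a) (hd : 0 ≤ d) (ht : 0 < t) :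
    IntegrableOn (fun r => E a d t r) (Ioi 0) := by
  have := intA (k := 0) ha hd ht (by norm_num)
  simpa using this

lemma intD {d : ℝ} (hd : 0 < d) : IntegrableOn (fun r => Real.exp (-(d * r))) (Ioi 0) := by
  simpa [neg_mul] using integrableOn_exp_mul_Ioi (a := -d) (by linarith) 0

lemma E_le {a d t r : ℝ} (ht : 0 ≤ t) (hr : 0 < r) : E a d t r ≤ Real.exp (-(d * r)) := by
  unfold E
  refine Real.exp_le_exp.2 ?_
  nlinarith [mul_nonneg ht (rpow_nonneg hr.le a)]

lemma intB {a d t : ℝ} (hd : 0 < d) (ht : 0 ≤ t) :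
    IntegrableOn (fun r => E a d t r) (Ioi 0) := by
  refine (intD hd).mono' (E_meas a d t).aestronglyMeasurable ?_
  refine ae_restrict_of_forall_mem measurableSet_Ioi fun r hr => ?_
  rw [Real.norm_of_nonneg (E_pos ..).le]
  exact E_le ht hr

lemma intCos {f : ℝ → ℝ} (hf : IntegrableOn f (Ioi 0)) (x : ℝ) :
    IntegrableOn (fun r => Real.cos (x*r) * f r) (Ioi 0) := by
  refine hf.norm.mono' ?_ ?_
  · exact (Measurable.aestronglyMeasurable (by fun_prop)).mul hf.aestronglyMeasurable
  · refine ae_of_all _ fun r => ?_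
    rw [norm_mul]
    exact mul_le_of_le_one_left (norm_nonneg _) (Real.abs_cos_le_one _)

lemma kerInt {a : ℝ} (ha : 0 < a) (ha2 : a < 2) :
    IntegrableOn (fun y : ℝ => (1 - Real.cos y) * y ^ (-1 - a)) (Ioi 0) := by
  have hm : Measurable (fun y : ℝ => (1 - Real.cos y) * y ^ (-1 - a)) := by fun_prop
  have h1 : IntegrableOn (fun y : ℝ => (1 - Real.cos y) * y ^ (-1 - a)) (Ioo 0 2) := by
    have := ((intervalIntegral.integrableOn_Ioo_rpow_iff (s := 1 - a) (t := 2) (by norm_num)).2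
      (by linarith))
    refine this.mono' hm.aestronglyMeasurable ?_
    refine ae_restrict_of_forall_mem measurableSet_Ioo fun y hy => ?_
    have hy0 : 0 < y := hy.1
    rw [norm_mul, Real.norm_of_nonneg (rpow_nonneg hy0.le _),
      Real.norm_of_nonneg (by linarith [Real.cos_le_one y])]
    have e : y ^ (1 - a) = y ^ 2 * y ^ (-1 - a) := by
      rw [← Real.rpow_natCast, ← Real.rpow_add hy0]; congr 1; push_cast; ring
    rw [e]
    refine mul_le_mul_of_nonneg_right ?_ (rpow_nonneg hy0.le _)
    nlinarith [Real.one_sub_sq_div_two_le_cos (x := y)]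
  have h2 : IntegrableOn (fun y : ℝ => (1 - Real.cos y) * y ^ (-1 - a)) (Ioi 1) := by
    have := (integrableOn_Ioi_rpow_of_lt (a := -1 - a) (c := 1) (by linarith) (by norm_num)).const_mul 2
    refine this.mono' hm.aestronglyMeasurable ?_
    refine ae_restrict_of_forall_mem measurableSet_Ioi fun y hy => ?_
    have hy0 : 0 < y := lt_trans one_pos hy
    rw [norm_mul, Real.norm_of_nonneg (rpow_nonneg hy0.le _),
      Real.norm_of_nonneg (by linarith [Real.cos_le_one y])]
    refine mul_le_mul_of_nonneg_right ?_ (rpow_nonneg hy0.le _)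
    linarith [Real.neg_one_le_cos y]
  refine (h1.union h2).mono_set ?_
  intro y hy
  have hy : 0 < y := hy
  rcases lt_or_ge y 2 with h | h
  · exact Or.inl ⟨hy, h⟩
  · exact Or.inr (show (1:ℝ) < y by linarith)

/-- The constant. -/
noncomputable def C (a : ℝ) : ℝ := ∫ y in Ioi (0:ℝ), (1 - Real.cos y) * y ^ (-1 - a)

lemma C_pos {a : ℝ} (ha : 0 < a) (ha2 : a < 2) : 0 < C a := by
  unfold C
  rw [setIntegral_pos_iff_support_of_nonneg_ae ?_ (kerInt ha ha2)]
  · refine lt_of_lt_of_le (b := volume (Ioo (0:ℝ) 1)) (by simp) (measure_mono ?_)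
    intro y hy
    refine ⟨?_, hy.1⟩
    refine (mul_pos ?_ (rpow_pos_of_pos hy.1 _)).ne'
    have := Real.cos_lt_cos_of_nonneg_of_le_pi (le_refl 0) (by linarith [hy.2, Real.pi_gt_three] : y ≤ π) hy.1
    rw [Real.cos_zero] at this
    linarith
  · refine ae_restrict_of_forall_mem measurableSet_Ioi fun y hy => ?_
    exact mul_nonneg (by linarith [Real.cos_le_one y]) (rpow_nonneg (le_of_lt hy) _)

lemma ker_eq {a r y : ℝ} (hr : 0 < r) (hy : 0 < y) :
    (1 - Real.cos (r * y)) * y ^ (-1 - a) =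
      r ^ (1 + a) * ((1 - Real.cos (r * y)) * (r * y) ^ (-1 - a)) := by
  rw [Real.mul_rpow hr.le hy.le]
  have : r ^ (1 + a) * r ^ (-1 - a) = 1 := by
    rw [← Real.rpow_add hr]; ring_nf; simp
  calc _ = (1 - Real.cos (r * y)) * y ^ (-1 - a) * (r ^ (1 + a) * r ^ (-1 - a)) := by rw [this]; ring
    _ = _ := by ring

lemma ker_int_scale {a r : ℝ} (ha : 0 < a) (ha2 : a < 2) (hr : 0 < r) :
    IntegrableOn (fun y : ℝ => (1 - Real.cos (r * y)) * y ^ (-1 - a)) (Ioi 0) := by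
  have h := (integrableOn_Ioi_comp_mul_left_iff (fun y : ℝ => (1 - Real.cos y) * y ^ (-1 - a)) 0 hr).2
    (by simpa using kerInt ha ha2)
  refine IntegrableOn.congr_fun (h.const_mul (r ^ (1 + a))) (fun y hy => ?_) measurableSet_Ioi
  exact (ker_eq hr hy).symm

lemma ker_scale {a r : ℝ} (hr : 0 < r) :
    ∫ y in Ioi (0:ℝ), (1 - Real.cos (r * y)) * y ^ (-1 - a) = C a * r ^ a := by
  rw [setIntegral_congr_fun measurableSet_Ioi (fun y hy => ker_eq (a := a) hr hy), integral_const_mul,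
    integral_comp_mul_left_Ioi (fun y : ℝ => (1 - Real.cos y) * y ^ (-1 - a)) 0 hr, mul_zero]
  change r ^ (1 + a) * (r⁻¹ * C a) = _
  rw [Real.rpow_add hr, Real.rpow_one]
  field_simp

lemma gen {a d t : ℝ} (ha : 0 < a) (ha2 : a < 2) (hd : 0 ≤ d) (ht : 0 < t) (x : ℝ) :
    IntegrableOn (fun y => (U a d t x - (U a d t (x + y) + U a d t (x - y)) / 2) * y ^ (-1 - a))
      (Ioi 0) ∧
    ∫ y in Ioi (0:ℝ), (U a d t x - (U a d t (x + y) + U a d t (x - y)) / 2) * y ^ (-1 - a)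
      = C a * ∫ r in Ioi (0:ℝ), Real.cos (x*r) * (r ^ a * E a d t r) := by
  set μ : Measure ℝ := volume.restrict (Ioi 0) with hμ
  set F : ℝ → ℝ → ℝ := fun r y =>
    (Real.cos (x * r) * E a d t r) * ((1 - Real.cos (r * y)) * y ^ (-1 - a)) with hF
  have hm : AEStronglyMeasurable (Function.uncurry F) (μ.prod μ) := by
    refine Measurable.aestronglyMeasurable ?_
    have := E_meas2 a d t
    simp only [hF, Function.uncurry_def]
    fun_prop
  have hint : Integrable (Function.uncurry F) (μ.prod μ) := by
    rw [integrable_prod_iff hm]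
    constructor
    · refine ae_restrict_of_forall_mem measurableSet_Ioi fun r hr => ?_
      exact (ker_int_scale ha ha2 hr).const_mul (Real.cos (x * r) * E a d t r)
    · have h1 : IntegrableOn (fun r => C a * |Real.cos (x * r) * (r ^ a * E a d t r)|) (Ioi 0) :=
        (intCos (intA ha hd ht (by linarith)) x).norm.const_mul _
      refine h1.congr_fun (fun r hr => ?_) measurableSet_Ioi
      have hr : 0 < r := hr
      have e : ∀ y ∈ Ioi (0:ℝ), ‖Function.uncurry F (r, y)‖ =
          |Real.cos (x * r) * E a d t r| * ((1 - Real.cos (r * y)) * y ^ (-1 - a)) := by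
        intro y hy
        have hy : 0 < y := hy
        simp only [hF, Function.uncurry_apply_pair]
        rw [norm_mul, Real.norm_eq_abs, Real.norm_of_nonneg]
        exact mul_nonneg (by linarith [Real.cos_le_one (r * y)]) (rpow_nonneg hy.le _)
      change _ = ∫ y in Ioi (0:ℝ), _
      rw [setIntegral_congr_fun measurableSet_Ioi e, integral_const_mul, ker_scale hr]
      simp only [abs_mul, abs_of_pos (rpow_pos_of_pos hr a)]
      ring
  have hin : ∀ y, ∫ r in Ioi (0:ℝ), F r y =
      (U a d t x - (U a d t (x + y) + U a d t (x - y)) / 2) * y ^ (-1 - a) := by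
    intro y
    have I := fun z => intCos (intA0 (a := a) ha hd ht) z
    have J : IntegrableOn (fun r => (Real.cos ((x + y) * r) * E a d t r
        + Real.cos ((x - y) * r) * E a d t r) / 2) (Ioi 0) := ((I _).add (I _)).div_const 2
    unfold U
    rw [← integral_add (I _) (I _), ← integral_div, ← integral_sub (I _) J,
      ← integral_mul_const]
    refine setIntegral_congr_fun measurableSet_Ioi fun r _ => ?_
    simp only [hF]
    rw [add_mul x y r, sub_mul x y r, Real.cos_add, Real.cos_sub, mul_comm r y]
    ring
  constructor
  · have := hint.integral_prod_right
    refine this.congr (ae_of_all _ fun y => ?_)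
    exact hin y
  · rw [← integral_const_mul]
    have := integral_integral_swap hint
    change ∫ r in Ioi (0:ℝ), ∫ y in Ioi (0:ℝ), F r y = ∫ y in Ioi (0:ℝ), ∫ r in Ioi (0:ℝ), F r y at this
    simp only [hin] at this
    rw [← this]
    refine setIntegral_congr_fun measurableSet_Ioi fun r hr => ?_
    simp only [hF]
    rw [integral_const_mul, ker_scale hr]
    ring

lemma deriv_t {a d t : ℝ} (ha : 0 < a) (hd : 0 ≤ d) (ht : 0 < t) (x : ℝ) :
    HasDerivAt (fun t => U a d t x)
      (-∫ r in Ioi (0:ℝ), Real.cos (x*r) * (r ^ a * E a d t r)) t := by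
  have key := hasDerivAt_integral_of_dominated_loc_of_deriv_le
    (μ := volume.restrict (Ioi (0:ℝ))) (x₀ := t) (s := Ioi (t / 2))
    (F := fun t r => Real.cos (x * r) * E a d t r)
    (F' := fun t r => -(Real.cos (x * r) * (r ^ a * E a d t r)))
    (bound := fun r => r ^ a * E a d (t / 2) r)
    (Ioi_mem_nhds (by linarith)) ?_ ?_ ?_ ?_ ?_ ?_
  · have := key.2
    rw [integral_neg] at this
    exact this
  · refine Eventually.of_forall fun t => Measurable.aestronglyMeasurable ?_
    have := E_meas a d t
    fun_prop
  · exact intCos (intA0 ha hd ht) x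
  · refine Measurable.aestronglyMeasurable ?_
    have := E_meas a d t
    fun_prop
  · refine ae_restrict_of_forall_mem measurableSet_Ioi fun r hr t' ht' => ?_
    have hr : 0 < r := hr
    have ht' : t / 2 < t' := ht'
    have hra := rpow_pos_of_pos hr a
    rw [norm_neg, norm_mul, Real.norm_eq_abs, Real.norm_of_nonneg (mul_pos hra (E_pos ..)).le]
    refine (mul_le_of_le_one_left (mul_pos hra (E_pos ..)).le (Real.abs_cos_le_one _)).trans ?_
    refine mul_le_mul_of_nonneg_left ?_ hra.le
    unfold E
    refine Real.exp_le_exp.2 ?_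
    nlinarith
  · exact intA ha hd (by linarith) (by linarith)
  · refine ae_of_all _ fun r t' _ => ?_
    have h1 : HasDerivAt (fun t => -(t * r ^ a + d * r)) (-(1 * r ^ a)) t' :=
      (((hasDerivAt_id t').mul_const _).add_const _).neg
    have h2 := (h1.exp.const_mul (Real.cos (x * r)))
    unfold E
    convert! h2 using 1
    ring

lemma U_zero {a d : ℝ} (hd : 0 < d) (x : ℝ) : 0 < U a d 0 x := by
  have hre : ((-d : ℂ) + x * Complex.I).re < 0 := by simp [hd]
  have h := integral_exp_mul_complex_Ioi hre 0
  have hi := integrableOn_exp_mul_complex_Ioi hre 0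
  have h2 : U a d 0 x = (∫ r : ℝ in Ioi 0, Complex.exp (((-d : ℂ) + x * Complex.I) * r)).re := by
    have := integral_re (𝕜 := ℂ) hi
    simp only [RCLike.re_to_complex] at this
    rw [← this]
    unfold U
    refine setIntegral_congr_fun measurableSet_Ioi fun r _ => ?_
    simp only [E, Complex.exp_re]
    simp [mul_comm]
  rw [h2, h]
  simp only [Complex.ofReal_zero, mul_zero, Complex.exp_zero, Complex.div_re, Complex.neg_re,
    Complex.one_re, Complex.neg_im, Complex.one_im, Complex.normSq_apply]
  simp
  exact div_pos hd (by nlinarith [mul_pos hd hd, mul_self_nonneg x])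

lemma decay {a d t : ℝ} (ha : 0 < a) (hd : 0 < d) (ht : 0 ≤ t) {x : ℝ} (hx : x ≠ 0) :
    |U a d t x| ≤ 1 / |x| := by
  set u' : ℝ → ℝ := fun r => E a d t r * -(t * (a * r ^ (a - 1)) + d) with hu'
  have hderiv : ∀ r ∈ Ioi (0:ℝ), HasDerivAt (E a d t) (u' r) r := by
    intro r hr
    have hr : 0 < r := hr
    have h1 : HasDerivAt (fun r => -(t * r ^ a + d * r)) (-(t * (a * r ^ (a - 1)) + d * 1)) r :=
      (((Real.hasDerivAt_rpow_const (Or.inl hr.ne')).const_mul t).add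
        ((hasDerivAt_id r).const_mul d)).neg
    rw [mul_one] at h1
    exact h1.exp
  have hcont : Continuous (E a d t) := by
    unfold E
    have := Real.continuous_rpow_const (q := a) ha.le
    fun_prop
  have hneg : ∀ r ∈ Ioi (0:ℝ), u' r ≤ 0 := by
    intro r hr
    have hr : 0 < r := hr
    have := mul_nonneg ht (mul_nonneg ha.le (rpow_nonneg hr.le (a - 1)))
    exact mul_nonpos_of_nonneg_of_nonpos (E_pos ..).le (by linarith)
  have hlim : Tendsto (E a d t) atTop (nhds 0) := by
    have h0 : Tendsto (fun r : ℝ => Real.exp (-(d * r))) atTop (nhds 0) :=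
      Real.tendsto_exp_neg_atTop_nhds_zero.comp (tendsto_id.const_mul_atTop hd)
    refine tendsto_of_tendsto_of_tendsto_of_le_of_le' tendsto_const_nhds h0
      (Eventually.of_forall fun r => (E_pos ..).le) ?_
    filter_upwards [eventually_gt_atTop 0] with r hr using E_le ht hr
  have hE0 : E a d t 0 = 1 := by simp [E, Real.zero_rpow ha.ne']
  have hui : IntegrableOn u' (Ioi 0) :=
    integrableOn_Ioi_deriv_of_nonpos hcont.continuousWithinAt hderiv hneg hlim
  have huI : ∫ r in Ioi (0:ℝ), u' r = 0 - 1 := by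
    rw [← hE0]
    exact integral_Ioi_of_hasDerivAt_of_nonpos hcont.continuousWithinAt hderiv hneg hlim
  have hv : ∀ r ∈ Ioi (0:ℝ), HasDerivAt (fun r => Real.sin (x * r) / x) (Real.cos (x * r)) r := by
    intro r _
    have h1 : HasDerivAt (fun r => x * r) (x * 1) r := (hasDerivAt_id r).const_mul x
    convert! (h1.sin.div_const x) using 1
    field_simp
  have hb : ∀ r, |Real.sin (x * r) / x| ≤ 1 / |x| := by
    intro r
    rw [abs_div]
    exact div_le_div_of_nonneg_right (Real.abs_sin_le_one _) (abs_nonneg x)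
  have hvc : Continuous (fun r => Real.sin (x * r) / x) := by fun_prop
  have hprod : IntegrableOn (u' * fun r => Real.sin (x * r) / x) (Ioi 0) := by
    refine (hui.norm.mul_const (1 / |x|)).mono'
      (hui.aestronglyMeasurable.mul hvc.aestronglyMeasurable) (ae_of_all _ fun r => ?_)
    rw [Pi.mul_apply, norm_mul]
    exact mul_le_mul_of_nonneg_left (hb r) (norm_nonneg _)
  have ibp := integral_Ioi_mul_deriv_eq_deriv_mul (u := E a d t) (v := fun r => Real.sin (x * r) / x)
    (u' := u') (v' := fun r => Real.cos (x * r)) (a := 0) (a' := 0) (b' := 0) hderiv hv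
    (by
      refine (intCos (intB (a := a) hd ht) x).congr_fun (fun r _ => ?_) measurableSet_Ioi
      simp [mul_comm])
    hprod
    (by
      have : Continuous (E a d t * fun r => Real.sin (x * r) / x) := hcont.mul hvc
      have := (this.tendsto 0).mono_left (nhdsWithin_le_nhds (s := Ioi 0))
      simpa using this)
    (by
      refine squeeze_zero_norm (a := fun r => E a d t r * (1 / |x|)) (fun r => ?_) ?_
      · rw [Pi.mul_apply, norm_mul, Real.norm_of_nonneg (E_pos ..).le]
        exact mul_le_mul_of_nonneg_left (hb r) (E_pos ..).le
      · simpa using hlim.mul_const (1 / |x|))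
  have hU : U a d t x = - ∫ r in Ioi (0:ℝ), u' r * (Real.sin (x * r) / x) := by
    unfold U
    simp_rw [mul_comm (Real.cos _)]
    rw [ibp]; ring
  rw [hU, abs_neg]
  calc |∫ r in Ioi (0:ℝ), u' r * (Real.sin (x * r) / x)|
      ≤ ∫ r in Ioi (0:ℝ), -u' r * (1 / |x|) := by
        rw [← Real.norm_eq_abs]
        refine norm_integral_le_of_norm_le (hui.neg.mul_const _) ?_
        refine ae_restrict_of_forall_mem measurableSet_Ioi fun r hr => ?_
        rw [norm_mul, Real.norm_of_nonpos (hneg r hr)]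
        exact mul_le_mul_of_nonneg_left (hb r) (by linarith [hneg r hr])
    _ = 1 / |x| := by
        rw [integral_mul_const, integral_neg, huI]; ring

lemma U_cont {a d : ℝ} (hd : 0 < d) : Continuous (fun p : ℝ × ℝ => U a d |p.1| p.2) := by
  unfold U
  refine continuous_of_dominated (bound := fun r => Real.exp (-(d * r))) ?_ ?_ (intD hd) ?_
  · intro p
    refine Measurable.aestronglyMeasurable ?_
    have := E_meas a d |p.1|
    fun_prop
  · intro p
    refine ae_restrict_of_forall_mem measurableSet_Ioi fun r hr => ?_
    rw [norm_mul, Real.norm_eq_abs, Real.norm_of_nonneg (E_pos ..).le]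
    exact (mul_le_of_le_one_left (E_pos ..).le (Real.abs_cos_le_one _)).trans
      (E_le (abs_nonneg _) hr)
  · refine ae_of_all _ fun r => ?_
    unfold E
    fun_prop

lemma left_deriv {g : ℝ → ℝ} {g' t : ℝ} (h : HasDerivAt g g' t) (ht : 0 < t)
    (hm : ∀ z ∈ Icc 0 t, g t ≤ g z) : g' ≤ 0 := by
  have h1 := (hasDerivAt_iff_tendsto_slope_left_right.1 h).1
  refine le_of_tendsto h1 ?_
  filter_upwards [Ioo_mem_nhdsLT ht] with z hz
  rw [slope_def_field]
  exact div_nonpos_of_nonneg_of_nonpos (by linarith [hm z ⟨hz.1.le, hz.2.le⟩]) (by linarith [hz.2])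

lemma nonneg_reg {a d T : ℝ} (ha : 0 < a) (ha2 : a < 2) (hd : 0 < d) (hT : 0 < T) (x₀ : ℝ) :
    0 ≤ U a d T x₀ := by
  by_contra hcon
  push Not at hcon
  set m : ℝ := -U a d T x₀ / 2 with hm
  have hmpos : 0 < m := by rw [hm]; linarith
  set η : ℝ := m / T with hη
  have hηpos : 0 < η := div_pos hmpos hT
  have hηT : η * T = m := by rw [hη]; field_simp
  set R : ℝ := |x₀| + 1 / m with hR
  have hRm : 1 / m ≤ R := by rw [hR]; linarith [abs_nonneg x₀]
  have hRx : |x₀| ≤ R := by rw [hR]; linarith [one_div_pos.2 hmpos]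
  have hwc : Continuous (fun p : ℝ × ℝ => U a d |p.1| p.2 + η * p.1) := by
    have := U_cont (a := a) hd
    fun_prop
  have hmem : (T, x₀) ∈ Icc (0:ℝ) T ×ˢ Icc (-R) R := ⟨⟨hT.le, le_rfl⟩, abs_le.1 hRx⟩
  obtain ⟨⟨t₁, x₁⟩, ⟨ht₁, hx₁⟩, hmin⟩ :=
    (isCompact_Icc.prod isCompact_Icc).exists_isMinOn ⟨_, hmem⟩ hwc.continuousOn
  rw [isMinOn_iff] at hmin
  simp only at ht₁ hx₁ hmin
  have hle : U a d t₁ x₁ + η * t₁ ≤ -m := by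
    have := hmin _ hmem
    simp only [abs_of_nonneg ht₁.1, abs_of_pos hT] at this
    rw [hηT] at this
    linarith
  have ht₁pos : 0 < t₁ := by
    rcases ht₁.1.eq_or_lt with h | h
    · rw [← h] at hle
      have := U_zero (a := a) hd x₁
      linarith
    · exact h
  have hspace : ∀ y, U a d t₁ x₁ ≤ U a d t₁ y := by
    intro y
    rcases le_or_gt |y| R with h | h
    · have := hmin (t₁, y) ⟨ht₁, abs_le.1 h⟩
      simp only [abs_of_nonneg ht₁.1] at this
      linarith
    · have hy : 0 < |y| := lt_trans (lt_of_lt_of_le (one_div_pos.2 hmpos) hRm) h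
      have h1 := decay (a := a) ha hd ht₁.1 (abs_pos.1 hy)
      have h2 : 1 / |y| < m := by
        rw [div_lt_iff₀ hy]
        have : 1 / m < |y| := lt_of_le_of_lt hRm h
        rw [div_lt_iff₀ hmpos] at this
        linarith
      have := mul_pos hηpos ht₁pos
      linarith [neg_abs_le (U a d t₁ y)]
  have hD := deriv_t (a := a) ha hd.le ht₁pos x₁
  have hg : HasDerivAt (fun t => U a d t x₁ + η * t)
      ((-∫ r in Ioi (0:ℝ), Real.cos (x₁*r) * (r ^ a * E a d t₁ r)) + η * 1) t₁ :=
    hD.add ((hasDerivAt_id t₁).const_mul η)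
  have h1 := left_deriv hg ht₁pos (by
    intro z hz
    have := hmin (z, x₁) ⟨⟨hz.1, hz.2.trans ht₁.2⟩, hx₁⟩
    simpa only [abs_of_nonneg ht₁.1, abs_of_nonneg hz.1] using this)
  have h2 := (gen ha ha2 hd.le ht₁pos x₁).2
  have h3 : ∫ y in Ioi (0:ℝ), (U a d t₁ x₁ - (U a d t₁ (x₁ + y) + U a d t₁ (x₁ - y)) / 2)
      * y ^ (-1 - a) ≤ 0 := by
    refine setIntegral_nonpos measurableSet_Ioi fun y hy => ?_
    refine mul_nonpos_of_nonpos_of_nonneg ?_ (rpow_nonneg (le_of_lt hy) _)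
    linarith [hspace (x₁ + y), hspace (x₁ - y)]
  rw [h2] at h3
  have h4 := nonpos_of_mul_nonpos_right h3 (C_pos ha ha2)
  linarith

lemma nonneg {a t : ℝ} (ha : 0 < a) (ha2 : a < 2) (ht : 0 < t) (x : ℝ) : 0 ≤ U a 0 t x := by
  have hc : Continuous (fun d : ℝ => U a |d| t x) := by
    unfold U
    refine continuous_of_dominated (bound := fun r => E a 0 t r) ?_ ?_ (intA0 ha le_rfl ht) ?_
    · intro d
      refine Measurable.aestronglyMeasurable ?_
      have := E_meas a |d| t
      fun_prop
    · intro d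
      refine ae_restrict_of_forall_mem measurableSet_Ioi fun r hr => ?_
      have hr : 0 < r := hr
      rw [norm_mul, Real.norm_eq_abs, Real.norm_of_nonneg (E_pos ..).le]
      refine (mul_le_of_le_one_left (E_pos ..).le (Real.abs_cos_le_one _)).trans ?_
      unfold E
      refine Real.exp_le_exp.2 ?_
      nlinarith [mul_nonneg (abs_nonneg d) hr.le]
    · refine ae_of_all _ fun r => ?_
      unfold E
      fun_prop
  have h := (hc.tendsto 0).mono_left (nhdsWithin_le_nhds (s := Ioi 0))
  simp only [abs_zero] at h
  refine ge_of_tendsto h ?_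
  filter_upwards [self_mem_nhdsWithin] with d hd
  have hd : 0 < d := hd
  rw [abs_of_pos hd]
  exact nonneg_reg ha ha2 hd ht x

lemma U_contx {a t : ℝ} (ha : 0 < a) (ht : 0 < t) : Continuous (fun x => U a 0 t x) := by
  unfold U
  refine continuous_of_dominated (bound := fun r => E a 0 t r) ?_ ?_ (intA0 ha le_rfl ht) ?_
  · intro x
    exact (intCos (intA0 ha le_rfl ht) x).aestronglyMeasurable
  · intro x
    refine ae_of_all _ fun r => ?_
    rw [norm_mul, Real.norm_eq_abs, Real.norm_of_nonneg (E_pos ..).le]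
    exact mul_le_of_le_one_left (E_pos ..).le (Real.abs_cos_le_one _)
  · refine ae_of_all _ fun r => ?_
    fun_prop

lemma pos_at_zero {a t : ℝ} (ha : 0 < a) (ht : 0 < t) : 0 < U a 0 t 0 := by
  unfold U
  have hi := intCos (intA0 (a := a) ha le_rfl ht) 0
  rw [setIntegral_pos_iff_support_of_nonneg_ae ?_ hi]
  · refine lt_of_lt_of_le (b := volume (Ioo (0:ℝ) 1)) (by simp) (measure_mono ?_)
    intro y hy
    refine ⟨?_, hy.1⟩
    simp [(E_pos ..).ne']
  · refine ae_of_all _ fun y => ?_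
    simp [(E_pos ..).le]

lemma pos {a t : ℝ} (ha : 0 < a) (ha2 : a < 2) (ht : 0 < t) (x : ℝ) : 0 < U a 0 t x := by
  refine lt_of_le_of_ne (nonneg ha ha2 ht x) fun h0 => ?_
  have hU0 : U a 0 t x = 0 := h0.symm
  have hx : x ≠ 0 := by
    rintro rfl
    exact (pos_at_zero ha ht).ne' hU0
  have hmin : IsLocalMin (fun t => U a 0 t x) t := by
    filter_upwards [Ioi_mem_nhds ht] with z hz
    rw [hU0]
    exact nonneg ha ha2 hz x
  have hD := hmin.hasDerivAt_eq_zero (deriv_t (a := a) ha le_rfl ht x)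
  obtain ⟨h1, h2⟩ := gen ha ha2 le_rfl ht x
  rw [neg_eq_zero.1 hD, mul_zero] at h2
  have hnn : ∀ y ∈ Ioi (0:ℝ), 0 ≤
      -((U a 0 t x - (U a 0 t (x + y) + U a 0 t (x - y)) / 2) * y ^ (-1 - a)) := by
    intro y hy
    rw [← neg_mul]
    refine mul_nonneg ?_ (rpow_nonneg (le_of_lt hy) _)
    linarith [nonneg ha ha2 ht (x + y), nonneg ha ha2 ht (x - y)]
  have h3 : 0 < ∫ y in Ioi (0:ℝ),
      -((U a 0 t x - (U a 0 t (x + y) + U a 0 t (x - y)) / 2) * y ^ (-1 - a)) := by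
    rw [setIntegral_pos_iff_support_of_nonneg_ae
      (ae_restrict_of_forall_mem measurableSet_Ioi hnn) h1.neg]
    have hopen : IsOpen ({y : ℝ | 0 < U a 0 t (x + y) + U a 0 t (x - y)} ∩ Ioi 0) := by
      refine IsOpen.inter (isOpen_lt continuous_const ?_) isOpen_Ioi
      have := U_contx (a := a) ha ht
      fun_prop
    refine lt_of_lt_of_le (hopen.measure_pos volume ⟨|x|, ?_, abs_pos.2 hx⟩) (measure_mono ?_)
    · have p0 := pos_at_zero (a := a) ha ht
      have n1 := nonneg ha ha2 ht (x + |x|)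
      have n2 := nonneg ha ha2 ht (x - |x|)
      show 0 < U a 0 t (x + |x|) + U a 0 t (x - |x|)
      rcases abs_cases x with ⟨h, _⟩ | ⟨h, _⟩
      · rw [h] at n1 ⊢
        rw [sub_self]
        linarith
      · rw [h] at n2 ⊢
        rw [add_neg_cancel]
        linarith
    · rintro y ⟨hy1, hy⟩
      refine ⟨?_, hy⟩
      have hy1 : 0 < U a 0 t (x + y) + U a 0 t (x - y) := hy1
      have hy : 0 < y := hy
      rw [Function.mem_support, ← neg_mul]
      refine (mul_pos ?_ (rpow_pos_of_pos hy _)).ne'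
      linarith
  rw [integral_neg, h2] at h3
  simp at h3

/-- Unnormalised layer. -/
noncomputable def W (a t x : ℝ) : ℝ := ∫ r in Ioi (0:ℝ), (Real.sin (x*r) / r) * E a 0 t r

lemma sin_div_le (x : ℝ) {r : ℝ} (hr : 0 < r) : |Real.sin (x * r) / r| ≤ |x| := by
  rw [abs_div, abs_of_pos hr, div_le_iff₀ hr]
  calc |Real.sin (x * r)| ≤ |x * r| := Real.abs_sin_le_abs
    _ = |x| * r := by rw [abs_mul, abs_of_pos hr]

lemma W_int {a t : ℝ} (ha : 0 < a) (ht : 0 < t) (x : ℝ) :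
    IntegrableOn (fun r => (Real.sin (x*r) / r) * E a 0 t r) (Ioi 0) := by
  refine ((intA0 ha le_rfl ht).const_mul |x|).mono' ?_ ?_
  · refine Measurable.aestronglyMeasurable ?_
    have := E_meas a 0 t
    fun_prop
  · refine ae_restrict_of_forall_mem measurableSet_Ioi fun r hr => ?_
    rw [norm_mul, Real.norm_eq_abs, Real.norm_of_nonneg (E_pos ..).le]
    exact mul_le_mul_of_nonneg_right (sin_div_le x hr) (E_pos ..).le

lemma W_deriv {a t : ℝ} (ha : 0 < a) (ht : 0 < t) (x : ℝ) :
    HasDerivAt (W a t) (U a 0 t x) x := by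
  have key := hasDerivAt_integral_of_dominated_loc_of_deriv_le
    (μ := volume.restrict (Ioi (0:ℝ))) (x₀ := x) (s := univ)
    (F := fun x r => (Real.sin (x * r) / r) * E a 0 t r)
    (F' := fun x r => Real.cos (x * r) * E a 0 t r)
    (bound := fun r => E a 0 t r)
    univ_mem ?_ (W_int ha ht x) ?_ ?_ (intA0 ha le_rfl ht) ?_
  · exact key.2
  · exact Eventually.of_forall fun x => (W_int ha ht x).aestronglyMeasurable
  · exact (intCos (intA0 ha le_rfl ht) x).aestronglyMeasurable
  · refine ae_of_all _ fun r x' _ => ?_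
    rw [norm_mul, Real.norm_eq_abs, Real.norm_of_nonneg (E_pos ..).le]
    exact mul_le_of_le_one_left (E_pos ..).le (Real.abs_cos_le_one _)
  · refine ae_restrict_of_forall_mem measurableSet_Ioi fun r hr x' _ => ?_
    have hr : 0 < r := hr
    have h1 : HasDerivAt (fun x => x * r) (1 * r) x' := (hasDerivAt_id x').mul_const r
    convert! ((h1.sin.div_const r).mul_const (E a 0 t r)) using 1
    field_simp

lemma W_mono {a t : ℝ} (ha : 0 < a) (ha2 : a < 2) (ht : 0 < t) : StrictMono (W a t) :=
  strictMono_of_deriv_pos fun x => by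
    rw [(W_deriv ha ht x).deriv]; exact pos ha ha2 ht x

lemma W_odd (a t x : ℝ) : W a t (-x) = - W a t x := by
  unfold W
  rw [← integral_neg]
  congr 1
  funext r
  rw [neg_mul x r, Real.sin_neg]
  ring

lemma W_zero (a t : ℝ) : W a t 0 = 0 := by simp [W]

lemma laplace_sin (b : ℝ) :
    ∫ u in Ioi (0:ℝ), Real.exp (-u) * Real.sin (b * u) = b / (1 + b ^ 2) := by
  have hre : ((-1 : ℂ) + b * Complex.I).re < 0 := by simp
  have h := integral_exp_mul_complex_Ioi hre 0
  have hi := integrableOn_exp_mul_complex_Ioi hre 0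
  have h2 : ∫ u in Ioi (0:ℝ), Real.exp (-u) * Real.sin (b * u)
      = (∫ r : ℝ in Ioi 0, Complex.exp (((-1 : ℂ) + b * Complex.I) * r)).im := by
    have := integral_im (𝕜 := ℂ) hi
    simp only [RCLike.im_to_complex] at this
    rw [← this]
    refine setIntegral_congr_fun measurableSet_Ioi fun r _ => ?_
    simp only [Complex.exp_im]
    simp
  rw [h2, h]
  simp only [Complex.ofReal_zero, mul_zero, Complex.exp_zero, Complex.div_im, Complex.neg_re,
    Complex.one_re, Complex.neg_im, Complex.one_im, Complex.normSq_apply]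
  simp
  ring

lemma abel {a t : ℝ} (ha : 0 < a) (ht : 0 < t) {n : ℝ} (hn : 0 < n) :
    IntegrableOn (fun u => Real.exp (-u) * W a t (n * u)) (Ioi 0) ∧
    ∫ u in Ioi (0:ℝ), Real.exp (-u) * W a t (n * u)
      = ∫ q in Ioi (0:ℝ), (1 + q ^ 2)⁻¹ * E a 0 t (n⁻¹ * q) := by
  set μ : Measure ℝ := volume.restrict (Ioi 0) with hμ
  set G : ℝ → ℝ → ℝ := fun u r => Real.exp (-u) * ((Real.sin (n * u * r) / r) * E a 0 t r) with hG
  have h1 : Integrable (fun u : ℝ => n * (u ^ (1:ℝ) * Real.exp (-1 * u ^ (1:ℝ)))) μ :=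
    (integrableOn_rpow_mul_exp_neg_mul_rpow (p := 1) (s := 1) (b := 1)
      (by norm_num) one_pos one_pos).const_mul n
  have h2 : Integrable (fun r : ℝ => E a 0 t r) μ := intA0 ha le_rfl ht
  have hint : Integrable (Function.uncurry G) (μ.prod μ) := by
    refine (h1.mul_prod h2).mono' ?_ ?_
    · refine Measurable.aestronglyMeasurable ?_
      have : Measurable (fun p : ℝ × ℝ => E a 0 t p.2) := (E_meas a 0 t).comp measurable_snd
      simp only [hG, Function.uncurry_def]
      fun_prop
    · rw [hμ, Measure.prod_restrict]
      refine ae_restrict_of_forall_mem (measurableSet_Ioi.prod measurableSet_Ioi) ?_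
      rintro ⟨u, r⟩ ⟨hu, hr⟩
      have hu : 0 < u := hu
      have hr : 0 < r := hr
      simp only [hG, Function.uncurry_apply_pair, Real.rpow_one]
      rw [norm_mul, norm_mul, Real.norm_of_nonneg (Real.exp_pos _).le,
        Real.norm_of_nonneg (E_pos ..).le, Real.norm_eq_abs]
      have := sin_div_le (n * u) hr
      rw [abs_of_pos (mul_pos hn hu)] at this
      calc _ ≤ Real.exp (-u) * ((n * u) * E a 0 t r) := by
            refine mul_le_mul_of_nonneg_left ?_ (Real.exp_pos _).le
            exact mul_le_mul_of_nonneg_right this (E_pos ..).le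
        _ = _ := by rw [neg_one_mul]; ring
  have hin : ∀ u, ∫ r in Ioi (0:ℝ), G u r = Real.exp (-u) * W a t (n * u) := by
    intro u
    simp only [hG]
    rw [integral_const_mul]
    rfl
  constructor
  · exact hint.integral_prod_left.congr (ae_of_all _ fun u => hin u)
  · have := integral_integral_swap hint
    change ∫ u in Ioi (0:ℝ), ∫ r in Ioi (0:ℝ), G u r = ∫ r in Ioi (0:ℝ), ∫ u in Ioi (0:ℝ), G u r at this
    simp only [hin] at this
    rw [this]
    have e : ∀ r ∈ Ioi (0:ℝ), ∫ u in Ioi (0:ℝ), G u r =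
        n * ((1 + (n * r) ^ 2)⁻¹ * E a 0 t (n⁻¹ * (n * r))) := by
      intro r hr
      have hr : 0 < r := hr
      have e2 : ∀ u ∈ Ioi (0:ℝ), G u r =
          (Real.exp (-u) * Real.sin ((n * r) * u)) * (E a 0 t r / r) := by
        intro u _
        simp only [hG]
        rw [show n * u * r = n * r * u by ring]
        ring
      rw [setIntegral_congr_fun measurableSet_Ioi e2, integral_mul_const, laplace_sin,
        inv_mul_cancel_left₀ hn.ne']
      field_simp
    rw [setIntegral_congr_fun measurableSet_Ioi e, integral_const_mul,
      integral_comp_mul_left_Ioi (fun q => (1 + q ^ 2)⁻¹ * E a 0 t (n⁻¹ * q)) 0 hn, mul_zero,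
      smul_eq_mul, mul_inv_cancel_left₀ hn.ne']

lemma E_le_one {a t r : ℝ} (ht : 0 < t) (hr : 0 ≤ r) : E a 0 t r ≤ 1 := by
  unfold E
  rw [Real.exp_le_one_iff]
  have := mul_nonneg ht.le (rpow_nonneg hr a)
  linarith

lemma abel_meas (a t n : ℝ) :
    Measurable (fun q : ℝ => (1 + q ^ 2)⁻¹ * E a 0 t (n⁻¹ * q)) := by
  have : Measurable (fun q : ℝ => E a 0 t (n⁻¹ * q)) := (E_meas a 0 t).comp (by fun_prop)
  fun_prop

lemma abel_bd {a t : ℝ} (ht : 0 < t) {n : ℝ} (hn : 0 < n) :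
    ∀ q ∈ Ioi (0:ℝ), ‖(1 + q ^ 2)⁻¹ * E a 0 t (n⁻¹ * q)‖ ≤ (1 + q ^ 2)⁻¹ := by
  intro q hq
  have hq : 0 < q := hq
  have h0 : 0 < (1 + q ^ 2)⁻¹ := by positivity
  rw [Real.norm_of_nonneg (mul_pos h0 (E_pos ..)).le]
  exact mul_le_of_le_one_right h0.le (E_le_one ht (by positivity))

lemma abel_lim {a t : ℝ} (ha : 0 < a) (ht : 0 < t) :
    Tendsto (fun n : ℝ => ∫ q in Ioi (0:ℝ), (1 + q ^ 2)⁻¹ * E a 0 t (n⁻¹ * q)) atTop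
      (nhds (π / 2)) := by
  have hI : ∫ q in Ioi (0:ℝ), (1 + q ^ 2)⁻¹ = π / 2 := by simp
  rw [← hI]
  refine tendsto_integral_filter_of_dominated_convergence (fun q => (1 + q ^ 2)⁻¹) ?_ ?_
    integrable_inv_one_add_sq.integrableOn ?_
  · exact Eventually.of_forall fun n => (abel_meas a t n).aestronglyMeasurable
  · filter_upwards [eventually_gt_atTop 0] with n hn
    exact ae_restrict_of_forall_mem measurableSet_Ioi (abel_bd ht hn)
  · refine ae_of_all _ fun q => ?_
    have hc : Continuous (E a 0 t) := by
      unfold E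
      have := Real.continuous_rpow_const (q := a) ha.le
      fun_prop
    have h1 : Tendsto (fun n : ℝ => n⁻¹ * q) atTop (nhds 0) := by
      simpa using tendsto_inv_atTop_zero.mul_const q
    have h2 := ((hc.tendsto 0).comp h1).const_mul ((1 + q ^ 2)⁻¹)
    have hE0 : E a 0 t 0 = 1 := by simp [E, Real.zero_rpow ha.ne']
    rw [hE0, mul_one] at h2
    exact h2

lemma W_bdd {a t : ℝ} (ha : 0 < a) (ha2 : a < 2) (ht : 0 < t) {n : ℝ} (hn : 0 < n) :
    W a t n ≤ Real.exp 1 * (π / 2) := by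
  obtain ⟨h1, h2⟩ := abel (a := a) ha ht hn
  have hup : ∫ q in Ioi (0:ℝ), (1 + q ^ 2)⁻¹ * E a 0 t (n⁻¹ * q) ≤ π / 2 := by
    have hI : ∫ q in Ioi (0:ℝ), (1 + q ^ 2)⁻¹ = π / 2 := by simp
    rw [← hI]
    refine (le_abs_self _).trans ?_
    exact norm_integral_le_of_norm_le integrable_inv_one_add_sq.integrableOn
      (ae_restrict_of_forall_mem measurableSet_Ioi (abel_bd ht hn))
  have hWn : ∀ x, 0 ≤ x → 0 ≤ W a t x := fun x hx => by
    rw [← W_zero a t]; exact (W_mono ha ha2 ht).monotone hx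
  have hlo : Real.exp (-1) * W a t n ≤ ∫ u in Ioi (0:ℝ), Real.exp (-u) * W a t (n * u) := by
    calc Real.exp (-1) * W a t n = ∫ u in Ioi (1:ℝ), Real.exp (-u) * W a t n := by
          rw [integral_mul_const, integral_exp_neg_Ioi]
      _ ≤ ∫ u in Ioi (1:ℝ), Real.exp (-u) * W a t (n * u) := by
          refine setIntegral_mono_on ?_ (h1.mono_set (Ioi_subset_Ioi zero_le_one))
            measurableSet_Ioi fun u hu => ?_
          · exact ((intD one_pos).mono_set (Ioi_subset_Ioi zero_le_one)).mul_const (W a t n) |>.congr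
              (ae_of_all _ fun u => by simp)
          · have hu : 1 < u := hu
            refine mul_le_mul_of_nonneg_left ((W_mono ha ha2 ht).monotone ?_) (Real.exp_pos _).le
            nlinarith
      _ ≤ _ := by
          refine setIntegral_mono_set h1 ?_ (Ioi_subset_Ioi zero_le_one).eventuallyLE
          refine ae_restrict_of_forall_mem measurableSet_Ioi fun u hu => ?_
          have hu : 0 < u := hu
          exact mul_nonneg (Real.exp_pos _).le (hWn _ (by positivity))
  rw [h2] at hlo
  have h3 := mul_le_mul_of_nonneg_left (hlo.trans hup) (Real.exp_pos 1).le
  rwa [← mul_assoc, ← Real.exp_add, add_neg_cancel, Real.exp_zero, one_mul] at h3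

lemma W_lim {a t : ℝ} (ha : 0 < a) (ha2 : a < 2) (ht : 0 < t) :
    Tendsto (W a t) atTop (nhds (π / 2)) := by
  have hmono := (W_mono ha ha2 ht).monotone
  have hb : BddAbove (range (W a t)) := by
    refine ⟨Real.exp 1 * (π / 2), ?_⟩
    rintro _ ⟨x, rfl⟩
    exact (hmono (le_max_left x 1)).trans (W_bdd ha ha2 ht (lt_of_lt_of_le one_pos (le_max_right x 1)))
  have hL := tendsto_atTop_ciSup hmono hb
  set L := ⨆ x, W a t x with hLdef
  have hWc : Continuous (W a t) :=
    continuous_iff_continuousAt.2 fun x => (W_deriv ha ht x).continuousAt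
  have hexp : IntegrableOn (fun u : ℝ => Real.exp (-u)) (Ioi 0) := by
    simpa using intD one_pos
  have h1 : Tendsto (fun n : ℝ => ∫ u in Ioi (0:ℝ), Real.exp (-u) * W a t (n * u)) atTop
      (nhds (∫ u in Ioi (0:ℝ), Real.exp (-u) * L)) := by
    refine tendsto_integral_filter_of_dominated_convergence (fun u => Real.exp (-u) * L) ?_ ?_
      (hexp.mul_const L) ?_
    · refine Eventually.of_forall fun n => Continuous.aestronglyMeasurable ?_
      fun_prop
    · filter_upwards [eventually_gt_atTop 0] with n hn
      refine ae_restrict_of_forall_mem measurableSet_Ioi fun u hu => ?_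
      have hu : 0 < u := hu
      have h0 : 0 ≤ W a t (n * u) := by
        rw [← W_zero a t]; exact hmono (by positivity)
      rw [Real.norm_of_nonneg (mul_nonneg (Real.exp_pos _).le h0)]
      exact mul_le_mul_of_nonneg_left (le_ciSup hb _) (Real.exp_pos _).le
    · refine ae_restrict_of_forall_mem measurableSet_Ioi fun u hu => ?_
      have hu : 0 < u := hu
      exact (hL.comp (tendsto_id.atTop_mul_const hu)).const_mul _
  rw [integral_mul_const, integral_exp_neg_Ioi, neg_zero, Real.exp_zero, one_mul] at h1
  have h2 : Tendsto (fun n : ℝ => ∫ u in Ioi (0:ℝ), Real.exp (-u) * W a t (n * u)) atTop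
      (nhds (π / 2)) := by
    refine (abel_lim ha ht).congr' ?_
    filter_upwards [eventually_gt_atTop 0] with n hn
    exact (abel ha ht hn).2.symm
  rw [← tendsto_nhds_unique h1 h2]
  exact hL

end FHK

/-- Positivity of the fractional heat kernel and monotonicity and limits of `v^t_s`. -/
theorem statement6 (s t : ℝ) (hs : s ∈ Set.Ioo (0:ℝ) 1) (ht : 0 < t) :
    (∀ x : ℝ, 0 < fracHeatKernel s t x) ∧
    StrictMono (layerV s t) ∧
    (∀ x : ℝ, deriv (layerV s t) x = 2 * fracHeatKernel s t x) ∧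
    Tendsto (layerV s t) atBot (nhds (-1)) ∧
    Tendsto (layerV s t) atTop (nhds 1) := by
  have ha : 0 < 2 * s := by linarith [hs.1]
  have ha2 : 2 * s < 2 := by linarith [hs.2]
  have hK : ∀ x, fracHeatKernel s t x = (1 / π) * FHK.U (2 * s) 0 t x := by
    intro x
    simp [fracHeatKernel, FHK.U, FHK.E]
  have hV : layerV s t = fun x => (2 / π) * FHK.W (2 * s) t x := by
    funext x
    simp [layerV, FHK.W, FHK.E]
  have hpi : (2 / π) * (π / 2) = 1 := by
    have := Real.pi_ne_zero
    field_simp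
  have hp2 : 0 < 2 / π := by positivity
  have hlim : Tendsto (layerV s t) atTop (nhds 1) := by
    rw [hV, ← hpi]
    exact (FHK.W_lim ha ha2 ht).const_mul _
  refine ⟨fun x => ?_, ?_, fun x => ?_, ?_, hlim⟩
  · rw [hK]
    exact mul_pos (by positivity) (FHK.pos ha ha2 ht x)
  · rw [hV]
    exact (FHK.W_mono ha ha2 ht).const_mul hp2
  · rw [hK, hV, ((FHK.W_deriv ha ht x).const_mul (2 / π)).deriv]
    ring
  · have h := (hlim.comp tendsto_neg_atBot_atTop).neg
    refine h.congr fun x => ?_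
    simp only [Function.comp_apply, hV, FHK.W_odd]
    ring
end

section
/- Let s ∈ (0,1) and t > 0. Then the function x ↦ p_s(t,x) is integrable on ℝ and its Fourier transform is ∫_ℝ p_s(t,x) e^{−i x ξ} dx = e^{−t |ξ|^{2s}} for every ξ ∈ ℝ. In particular, ∫_ℝ p_s(t,x) dx = 1. -/
open Real MeasureTheory Filter Set

lemma aux_int_cos {F : ℝ → ℝ} (hF : IntegrableOn F (Ioi 0)) (x : ℝ) :
    IntegrableOn (fun r => Real.cos (x * r) * F r) (Ioi 0) := by
  refine Integrable.bdd_mul (c := 1) hF (by fun_prop) ?_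
  exact ae_of_all _ fun r => by simpa using Real.abs_cos_le_one _

lemma aux_int_sin {F : ℝ → ℝ} (hF : IntegrableOn F (Ioi 0)) (x : ℝ) :
    IntegrableOn (fun r => Real.sin (x * r) * F r) (Ioi 0) := by
  refine Integrable.bdd_mul (c := 1) hF (by fun_prop) ?_
  exact ae_of_all _ fun r => by simpa using Real.abs_sin_le_one _

lemma aux_bdd_tendsto {l : Filter ℝ} {F b : ℝ → ℝ} (hF : Tendsto F l (nhds 0))
    (hb : ∀ r, |b r| ≤ 1) : Tendsto (fun r => F r * b r) l (nhds 0) := by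
  refine squeeze_zero_norm (a := fun r => |F r|) (fun r => ?_) (by simpa using hF.abs)
  rw [norm_mul]
  exact mul_le_of_le_one_right (abs_nonneg _) (hb r)

lemma aux_ibp_cos {F g : ℝ → ℝ} {L x : ℝ} (hx : 0 < x)
    (hd : ∀ r ∈ Ioi (0:ℝ), HasDerivAt F (-g r) r)
    (hF : IntegrableOn F (Ioi 0)) (hg : IntegrableOn g (Ioi 0))
    (h0 : Tendsto F (nhdsWithin 0 (Ioi 0)) (nhds L)) :
    ∫ r in Ioi (0:ℝ), Real.cos (x * r) * F r
      = (1 / x) * ∫ r in Ioi (0:ℝ), Real.sin (x * r) * g r := by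
  have hinf : Tendsto F atTop (nhds 0) :=
    tendsto_zero_of_hasDerivAt_of_integrableOn_Ioi hd hg.neg hF
  have hv : ∀ r ∈ Ioi (0:ℝ), HasDerivAt (fun r => Real.sin (x * r)) (x * Real.cos (x * r)) r := by
    intro r _
    have := ((hasDerivAt_id r).const_mul x).sin
    simpa [mul_comm] using this
  have key := integral_Ioi_mul_deriv_eq_deriv_mul (a' := L * 0) (b' := 0) hd hv ?_ ?_ ?_ ?_
  · have e1 : ∫ r in Ioi (0:ℝ), F r * (x * Real.cos (x * r))
        = x * ∫ r in Ioi (0:ℝ), Real.cos (x * r) * F r := by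
      rw [← integral_const_mul]; congr 1; ext r; ring
    have e2 : ∫ r in Ioi (0:ℝ), -g r * Real.sin (x * r)
        = - ∫ r in Ioi (0:ℝ), Real.sin (x * r) * g r := by
      rw [← integral_neg]; congr 1; ext r; ring
    rw [e1, e2] at key
    field_simp
    linarith
  · refine ((aux_int_cos hF x).const_mul x).congr (ae_of_all _ fun r => ?_)
    simp only [Pi.mul_apply]; ring
  · refine ((aux_int_sin hg x).neg).congr (ae_of_all _ fun r => ?_)
    simp only [Pi.mul_apply, Pi.neg_apply]; ring
  · refine h0.mul ?_
    have : Continuous (fun r => Real.sin (x * r)) := by fun_prop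
    have := (this.tendsto 0).mono_left (nhdsWithin_le_nhds (s := Ioi 0))
    simpa using this
  · exact aux_bdd_tendsto hinf (fun r => Real.abs_sin_le_one _)

lemma aux_ibp_sin {g g' : ℝ → ℝ} {x : ℝ} (hx : 0 < x)
    (hd : ∀ r ∈ Ioi (0:ℝ), HasDerivAt g (g' r) r)
    (hg : IntegrableOn g (Ioi 0)) (hg' : IntegrableOn g' (Ioi 0))
    (h0 : Tendsto g (nhdsWithin 0 (Ioi 0)) (nhds 0)) :
    |∫ r in Ioi (0:ℝ), Real.sin (x * r) * g r| ≤ (1 / x) * ∫ r in Ioi (0:ℝ), |g' r| := by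
  have hinf : Tendsto g atTop (nhds 0) :=
    tendsto_zero_of_hasDerivAt_of_integrableOn_Ioi hd hg' hg
  have hv : ∀ r ∈ Ioi (0:ℝ), HasDerivAt (fun r => Real.cos (x * r)) (-(x * Real.sin (x * r))) r := by
    intro r _
    have := ((hasDerivAt_id r).const_mul x).cos
    simpa [mul_comm] using this
  have key := integral_Ioi_mul_deriv_eq_deriv_mul (a' := 0) (b' := 0) hd hv ?_ ?_ ?_ ?_
  · have e1 : ∫ r in Ioi (0:ℝ), g r * (-(x * Real.sin (x * r)))
        = -x * ∫ r in Ioi (0:ℝ), Real.sin (x * r) * g r := by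
      rw [← integral_const_mul]; congr 1; ext r; ring
    have e2 : ∫ r in Ioi (0:ℝ), g' r * Real.cos (x * r)
        = ∫ r in Ioi (0:ℝ), Real.cos (x * r) * g' r := by
      congr 1; ext r; ring
    rw [e1, e2] at key
    have e3 : ∫ r in Ioi (0:ℝ), Real.sin (x * r) * g r
        = (1 / x) * ∫ r in Ioi (0:ℝ), Real.cos (x * r) * g' r := by
      field_simp
      linarith
    rw [e3, abs_mul, abs_of_pos (by positivity : 0 < 1 / x)]
    refine mul_le_mul_of_nonneg_left ?_ (by positivity)
    refine (abs_integral_le_integral_abs).trans ?_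
    refine integral_mono (aux_int_cos hg' x).abs hg'.abs fun r => ?_
    simp only [abs_mul]
    exact mul_le_of_le_one_left (abs_nonneg _) (Real.abs_cos_le_one _)
  · refine ((aux_int_sin hg x).const_mul (-x)).congr (ae_of_all _ fun r => ?_)
    simp only [Pi.mul_apply]; ring
  · refine ((aux_int_cos hg' x)).congr (ae_of_all _ fun r => ?_)
    simp only [Pi.mul_apply]; ring
  · exact aux_bdd_tendsto h0 (fun r => Real.abs_cos_le_one _)
  · exact aux_bdd_tendsto hinf (fun r => Real.abs_cos_le_one _)

lemma aux_shift (f : ℝ → ℝ) (h : ℝ) :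
    ∫ r in Ioi (0:ℝ), f (r + h) = ∫ r in Ioi h, f r := by
  have := (measurePreserving_add_right volume h).setIntegral_preimage_emb
    (measurableEmbedding_addRight h) f (Ioi h)
  simpa using this

lemma aux_shift_int {f : ℝ → ℝ} {h : ℝ} (hf : IntegrableOn f (Ioi h)) :
    IntegrableOn (fun r => f (r + h)) (Ioi 0) := by
  have := ((measurePreserving_add_right volume h).integrableOn_comp_preimage
    (measurableEmbedding_addRight h) (f := f) (s := Ioi h)).2 hf
  simpa [Function.comp_def] using this

lemma aux_anti_sin {g : ℝ → ℝ} {x : ℝ} (hx : 0 < x)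
    (hg : IntegrableOn g (Ioi 0)) (hanti : AntitoneOn g (Ioi 0))
    (hpos : ∀ r ∈ Ioi (0:ℝ), 0 ≤ g r) :
    |∫ r in Ioi (0:ℝ), Real.sin (x * r) * g r| ≤ ∫ r in Ioc 0 (π / x), g r := by
  set h := π / x with hh
  have hh0 : 0 < h := by positivity
  have hU : Ioc 0 h ∪ Ioi h = Ioi 0 := Ioc_union_Ioi_eq_Ioi hh0.le
  have hs1 : Ioc 0 h ⊆ Ioi (0:ℝ) := fun r hr => hr.1
  have hs2 : Ioi h ⊆ Ioi (0:ℝ) := fun r hr => hh0.trans hr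
  have split : ∀ f : ℝ → ℝ, IntegrableOn f (Ioi 0) →
      ∫ r in Ioi (0:ℝ), f r = (∫ r in Ioc 0 h, f r) + ∫ r in Ioi (0:ℝ), f (r + h) := by
    intro f hf
    rw [aux_shift, ← hU, setIntegral_union (Ioc_disjoint_Ioi le_rfl) measurableSet_Ioi
      (hf.mono_set hs1) (hf.mono_set hs2)]
  have hgs : IntegrableOn (fun r => g (r + h)) (Ioi 0) := aux_shift_int (hg.mono_set hs2)
  have hsin := aux_int_sin hg x
  have s1 := split _ hsin
  have s2 := split _ hg
  have e1 : ∫ r in Ioi (0:ℝ), Real.sin (x * (r + h)) * g (r + h)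
      = - ∫ r in Ioi (0:ℝ), Real.sin (x * r) * g (r + h) := by
    rw [← integral_neg]; congr 1; ext r
    have : x * (r + h) = x * r + π := by rw [hh]; field_simp
    rw [this, Real.sin_add_pi]; ring
  rw [e1] at s1
  have e2 : ∫ r in Ioi (0:ℝ), Real.sin (x * r) * (g r - g (r + h))
      = (∫ r in Ioi (0:ℝ), Real.sin (x * r) * g r)
        - ∫ r in Ioi (0:ℝ), Real.sin (x * r) * g (r + h) := by
    rw [← integral_sub hsin (aux_int_sin hgs x)]; congr 1; ext r; ring
  have b1 : |∫ r in Ioc 0 h, Real.sin (x * r) * g r| ≤ ∫ r in Ioc 0 h, g r := by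
    refine (abs_integral_le_integral_abs).trans ?_
    refine setIntegral_mono_on (hsin.mono_set hs1).abs (hg.mono_set hs1) measurableSet_Ioc
      fun r hr => ?_
    rw [abs_mul, abs_of_nonneg (hpos r hr.1)]
    exact mul_le_of_le_one_left (hpos r hr.1) (Real.abs_sin_le_one _)
  have b2 : |∫ r in Ioi (0:ℝ), Real.sin (x * r) * (g r - g (r + h))|
      ≤ ∫ r in Ioi (0:ℝ), (g r - g (r + h)) := by
    refine (abs_integral_le_integral_abs).trans ?_
    refine setIntegral_mono_on (aux_int_sin (hg.sub hgs) x).abs (hg.sub hgs) measurableSet_Ioi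
      fun r hr => ?_
    have : g (r + h) ≤ g r := hanti hr (by
      simp only [mem_Ioi] at hr ⊢; linarith) (by linarith)
    simp only [abs_mul]
    rw [abs_of_nonneg (by linarith : 0 ≤ g r - g (r + h))]
    exact mul_le_of_le_one_left (by linarith) (Real.abs_sin_le_one _)
  rw [integral_sub hg hgs] at b2
  rw [abs_le] at *
  constructor <;> linarith [b1.1, b1.2, b2.1, b2.2]

lemma aux_int_rpow_exp {p q b : ℝ} (hp : 0 < p) (hq : -1 < q) (hb : 0 < b) :
    IntegrableOn (fun r : ℝ => r ^ q * Real.exp (-(b * r ^ p))) (Ioi 0) := by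
  have h := integral_rpow_mul_exp_neg_mul_rpow hp hq hb
  simp only [neg_mul] at h
  by_contra hn
  rw [integral_undef hn] at h
  have : 0 < b ^ (-(q + 1) / p) * (1 / p) * Real.Gamma ((q + 1) / p) := by
    have := Real.Gamma_pos_of_pos (s := (q + 1) / p) (by apply div_pos <;> linarith)
    positivity
  linarith

lemma aux_int_exp {p b : ℝ} (hp : 0 < p) (hb : 0 < b) :
    IntegrableOn (fun r : ℝ => Real.exp (-(b * r ^ p))) (Ioi 0) := by
  simpa using aux_int_rpow_exp hp (by norm_num : (-1:ℝ) < 0) hb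

lemma aux_deriv_F {p b r : ℝ} (hr : 0 < r) :
    HasDerivAt (fun r : ℝ => Real.exp (-(b * r ^ p)))
      (-(b * p * (r ^ (p - 1) * Real.exp (-(b * r ^ p))))) r := by
  have := (((Real.hasDerivAt_rpow_const (p := p) (Or.inl hr.ne')).const_mul b).fun_neg).exp
  convert this using 1; ring

/-- Decay of the cosine transform. -/
lemma aux_decay {p b : ℝ} (hp : 0 < p) (hb : 0 < b) :
    ∃ C a : ℝ, 0 < a ∧ ∀ x : ℝ, 0 < x →
      |∫ r in Ioi (0:ℝ), Real.cos (x * r) * Real.exp (-(b * r ^ p))| ≤ C * x ^ (-1 - a) := by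
  set g : ℝ → ℝ := fun r => b * p * (r ^ (p - 1) * Real.exp (-(b * r ^ p))) with hgdef
  have hF := aux_int_exp hp hb
  have hg : IntegrableOn g (Ioi 0) := (aux_int_rpow_exp hp (by linarith) hb).const_mul _
  have h0 : Tendsto (fun r : ℝ => Real.exp (-(b * r ^ p))) (nhdsWithin 0 (Ioi 0))
      (nhds (Real.exp (-(b * 0 ^ p)))) := by
    have : Continuous (fun r : ℝ => Real.exp (-(b * r ^ p))) :=
      Real.continuous_exp.comp ((continuous_const.mul
        (Real.continuous_rpow_const hp.le)).neg)
    exact (this.tendsto 0).mono_left nhdsWithin_le_nhds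
  have step1 : ∀ x : ℝ, 0 < x → |∫ r in Ioi (0:ℝ), Real.cos (x * r) * Real.exp (-(b * r ^ p))|
      = (1 / x) * |∫ r in Ioi (0:ℝ), Real.sin (x * r) * g r| := by
    intro x hx
    rw [aux_ibp_cos hx (fun r hr => aux_deriv_F hr) hF hg h0, abs_mul,
      abs_of_pos (by positivity : 0 < 1 / x)]
  rcases le_or_gt p 1 with hp1 | hp1
  · refine ⟨b * π ^ p, p, hp, fun x hx => ?_⟩
    rw [step1 x hx]
    have hanti : AntitoneOn g (Ioi 0) := by
      intro r hr u hu hru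
      simp only [mem_Ioi] at hr hu
      have h1 : u ^ (p - 1) ≤ r ^ (p - 1) :=
        Real.rpow_le_rpow_of_nonpos hr hru (by linarith)
      have h2 : r ^ p ≤ u ^ p := Real.rpow_le_rpow hr.le hru hp.le
      simp only [hgdef]
      gcongr
    have hpos : ∀ r ∈ Ioi (0:ℝ), 0 ≤ g r := by
      intro r hr
      simp only [mem_Ioi] at hr
      simp only [hgdef]; positivity
    have k1 := aux_anti_sin hx hg hanti hpos
    have hh0 : 0 < π / x := by positivity
    have k2 : ∫ r in Ioc 0 (π / x), g r ≤ b * (π / x) ^ p := by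
      have e : ∫ r in Ioc 0 (π / x), b * p * r ^ (p - 1) = b * (π / x) ^ p := by
        rw [integral_const_mul, ← intervalIntegral.integral_of_le hh0.le,
          integral_rpow (Or.inl (by linarith)), sub_add_cancel, Real.zero_rpow hp.ne']
        field_simp; ring
      rw [← e]
      refine setIntegral_mono_on (hg.mono_set fun r hr => hr.1) ?_ measurableSet_Ioc fun r hr => ?_
      · refine Integrable.const_mul ?_ _
        have := intervalIntegral.intervalIntegrable_rpow' (a := 0) (b := π / x)
          (r := p - 1) (by linarith)
        exact (intervalIntegrable_iff_integrableOn_Ioc_of_le hh0.le).1 this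
      · simp only [hgdef]
        have hr0 : 0 < r := hr.1
        have : Real.exp (-(b * r ^ p)) ≤ 1 := Real.exp_le_one_iff.2 (by
          have : 0 ≤ b * r ^ p := by positivity
          linarith)
        refine mul_le_mul_of_nonneg_left ?_ (by positivity)
        exact mul_le_of_le_one_right (by positivity) this
    calc (1 / x) * |∫ r in Ioi (0:ℝ), Real.sin (x * r) * g r|
        ≤ (1 / x) * (b * (π / x) ^ p) :=
          mul_le_mul_of_nonneg_left (k1.trans k2) (by positivity)
      _ = b * π ^ p * x ^ (-1 - p) := by
          rw [Real.rpow_sub hx, Real.rpow_neg_one, Real.div_rpow pi_pos.le hx.le]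
          field_simp
  · set g' : ℝ → ℝ := fun r => b * p * ((p - 1) * (r ^ (p - 2) * Real.exp (-(b * r ^ p)))
      - b * p * (r ^ (2 * p - 2) * Real.exp (-(b * r ^ p)))) with hg'def
    refine ⟨∫ r in Ioi (0:ℝ), |g' r|, 1, one_pos, fun x hx => ?_⟩
    rw [step1 x hx]
    have hg' : IntegrableOn g' (Ioi 0) :=
      (((aux_int_rpow_exp hp (by linarith) hb).const_mul _).sub
        ((aux_int_rpow_exp hp (by linarith) hb).const_mul _)).const_mul _
    have hd : ∀ r ∈ Ioi (0:ℝ), HasDerivAt g (g' r) r := by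
      intro r hr
      simp only [mem_Ioi] at hr
      have := ((Real.hasDerivAt_rpow_const (p := p - 1) (Or.inl hr.ne')).mul
        (aux_deriv_F (p := p) (b := b) hr)).const_mul (b * p)
      refine HasDerivAt.congr_deriv (f := g) this ?_
      simp only [hg'def]
      have e : r ^ (2 * p - 2) = r ^ (p - 1) * r ^ (p - 1) := by
        rw [← Real.rpow_add hr]; congr 1; ring
      rw [e, show p - 1 - 1 = p - 2 by ring]; ring
    have hg0 : Tendsto g (nhdsWithin 0 (Ioi 0)) (nhds 0) := by
      have : Continuous g :=
        continuous_const.mul ((Real.continuous_rpow_const (by linarith)).mul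
          (Real.continuous_exp.comp ((continuous_const.mul
            (Real.continuous_rpow_const hp.le)).neg)))
      have := (this.tendsto 0).mono_left (nhdsWithin_le_nhds (s := Ioi 0))
      simpa [hgdef, Real.zero_rpow (by linarith : p - 1 ≠ 0)] using this
    calc (1 / x) * |∫ r in Ioi (0:ℝ), Real.sin (x * r) * g r|
        ≤ (1 / x) * ((1 / x) * ∫ r in Ioi (0:ℝ), |g' r|) :=
          mul_le_mul_of_nonneg_left (aux_ibp_sin hx hd hg hg' hg0) (by positivity)
      _ = (∫ r in Ioi (0:ℝ), |g' r|) * x ^ (-1 - 1 : ℝ) := by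
          rw [Real.rpow_sub hx, Real.rpow_neg_one, Real.rpow_one]
          field_simp

/-- The symbol. -/
lemma aux_phi {p b : ℝ} (hp : 0 < p) (hb : 0 < b) :
    Continuous (fun r : ℝ => (Real.exp (-(b * |r| ^ p)) : ℂ)) ∧
    Integrable (fun r : ℝ => (Real.exp (-(b * |r| ^ p)) : ℂ)) := by
  constructor
  · exact Complex.continuous_ofReal.comp (Real.continuous_exp.comp ((continuous_const.mul
      ((Real.continuous_rpow_const hp.le).comp continuous_abs)).neg))
  · suffices Integrable (fun r : ℝ => Real.exp (-(b * |r| ^ p))) from this.ofReal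
    have h := integral_comp_abs (f := fun r : ℝ => Real.exp (-(b * r ^ p)))
    by_contra hn
    rw [integral_undef hn] at h
    have h2 := integral_rpow_mul_exp_neg_mul_rpow hp (by norm_num : (-1:ℝ) < 0) hb
    simp only [neg_mul, Real.rpow_zero, one_mul] at h2
    rw [h2] at h
    have : 0 < Real.Gamma ((0 + 1) / p) := Real.Gamma_pos_of_pos (by positivity)
    have : 0 < b ^ (-(0 + 1) / p) * (1 / p) * Real.Gamma ((0 + 1) / p) := by positivity
    linarith

open FourierTransform in
lemma aux_fourier {s t : ℝ} (hs : 0 < s) (ht : 0 < t) (y : ℝ) :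
    𝓕 (fun r : ℝ => ((Real.exp (-(t * |r| ^ (2*s))) : ℝ) : ℂ)) y
      = ((2 * π * fracHeatKernel s t (2 * π * y) : ℝ) : ℂ) := by
  obtain ⟨-, hi⟩ := aux_phi (p := 2 * s) (b := t) (by linarith) ht
  rw [Real.fourier_real_eq_integral_exp_smul]
  set G : ℝ → ℂ := fun v => Complex.exp (↑(-2 * π * v * y) * Complex.I) •
    ((Real.exp (-(t * |v| ^ (2*s))) : ℝ) : ℂ) with hG
  have hGi : Integrable G := by
    refine Integrable.bdd_mul (c := 1) hi (by fun_prop) ?_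
    exact ae_of_all _ fun r => (Complex.norm_exp_ofReal_mul_I _).le
  have e1 : ∫ v, G v = ∫ v in Ioi (0:ℝ), (G (-v) + G v) := by
    have hn : IntegrableOn (fun v => G (-v)) (Ioi 0) := hGi.comp_neg.integrableOn
    rw [integral_add hn hGi.integrableOn, integral_comp_neg_Ioi 0 G, neg_zero,
      ← setIntegral_union (Iic_disjoint_Ioi le_rfl) measurableSet_Ioi hGi.integrableOn
        hGi.integrableOn, Iic_union_Ioi, setIntegral_univ]
  have e2 : 2 * π * fracHeatKernel s t (2 * π * y)
      = ∫ r in Ioi (0:ℝ), 2 * (Real.cos (2 * π * y * r) * Real.exp (-(t * r ^ (2*s)))) := by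
    rw [integral_const_mul, fracHeatKernel]
    field_simp
  rw [e1, e2, ← integral_complex_ofReal]
  refine setIntegral_congr_fun measurableSet_Ioi fun v hv => ?_
  have hv' : 0 < v := hv
  simp only [hG, abs_neg, abs_of_pos hv', smul_eq_mul, Complex.ofReal_mul, Complex.ofReal_cos]
  rw [Complex.cos]
  have a1 : ((-2 : ℝ) : ℂ) * (π : ℂ) * ((-v : ℝ) : ℂ) * (y : ℂ) * Complex.I
      = (2 : ℝ) * (π : ℂ) * y * v * Complex.I := by push_cast; ring
  have a2 : ((-2 : ℝ) : ℂ) * (π : ℂ) * (v : ℂ) * (y : ℂ) * Complex.I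
      = -((2 : ℝ) * (π : ℂ) * y * v) * Complex.I := by push_cast; ring
  rw [a1, a2]
  push_cast
  ring

lemma aux_kernel_even (s t x : ℝ) : fracHeatKernel s t (-x) = fracHeatKernel s t x := by
  simp [fracHeatKernel]

lemma aux_kernel_cont {s t : ℝ} (hs : 0 < s) (ht : 0 < t) : Continuous (fracHeatKernel s t) := by
  unfold fracHeatKernel
  refine continuous_const.mul ?_
  have hi := aux_int_exp (p := 2 * s) (b := t) (by linarith) ht
  refine continuous_of_dominated (bound := fun r => Real.exp (-(t * r ^ (2*s))))
    (fun x => (aux_int_cos hi x).aestronglyMeasurable) (fun x => ae_of_all _ fun r => ?_) hi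
    (ae_of_all _ fun r => by fun_prop)
  rw [norm_mul, Real.norm_eq_abs, Real.norm_eq_abs, Real.abs_exp]
  exact mul_le_of_le_one_left (Real.exp_pos _).le (Real.abs_cos_le_one _)

lemma aux_kernel_int {s t : ℝ} (hs : 0 < s) (ht : 0 < t) : Integrable (fracHeatKernel s t) := by
  obtain ⟨C, a, ha, hC⟩ := aux_decay (p := 2 * s) (b := t) (by linarith) ht
  refine ((aux_kernel_cont hs ht).locallyIntegrable).integrable_of_isBigO_atTop_of_norm_isNegInvariant
    (g := fun x : ℝ => x ^ (-1 - a)) ?_ ?_ ?_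
  · exact ae_of_all _ fun x => by simp [aux_kernel_even]
  · refine Asymptotics.IsBigO.of_bound (1 / π * C) ?_
    filter_upwards [eventually_gt_atTop 0] with x hx
    rw [fracHeatKernel, norm_mul, Real.norm_eq_abs, Real.norm_eq_abs, Real.norm_eq_abs,
      abs_of_pos (by positivity : 0 < 1 / π), abs_of_pos (Real.rpow_pos_of_pos hx _), mul_assoc]
    exact mul_le_mul_of_nonneg_left (hC x hx) (by positivity)
  · exact ⟨Ioi 1, Ioi_mem_atTop 1, integrableOn_Ioi_rpow_of_lt (by linarith) one_pos⟩

/-- Integrability and Fourier transform of the fractional heat kernel. -/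
theorem statement7 (s t : ℝ) (hs : s ∈ Set.Ioo (0:ℝ) 1) (ht : 0 < t) :
    Integrable (fracHeatKernel s t) ∧
    (∀ ξ : ℝ, ∫ x : ℝ, (fracHeatKernel s t x : ℂ) * Complex.exp (-(Complex.I * x * ξ))
        = (Real.exp (-(t * |ξ| ^ (2*s))) : ℂ)) ∧
    (∫ x : ℝ, fracHeatKernel s t x) = 1 := by
  have hi := aux_kernel_int hs.1 ht
  have hmain : ∀ ξ : ℝ, ∫ x : ℝ, (fracHeatKernel s t x : ℂ) * Complex.exp (-(Complex.I * x * ξ))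
        = (Real.exp (-(t * |ξ| ^ (2*s))) : ℂ) := by
    intro ξ
    obtain ⟨hc, hphi⟩ := aux_phi (p := 2 * s) (b := t) (by linarith [hs.1]) ht
    have hF : FourierTransform.fourier (fun r : ℝ => ((Real.exp (-(t * |r| ^ (2*s))) : ℝ) : ℂ))
        = fun y : ℝ => ((2 * π * fracHeatKernel s t (2 * π * y) : ℝ) : ℂ) :=
      funext fun y => aux_fourier hs.1 ht y
    have hFi : Integrable
        (FourierTransform.fourier (fun r : ℝ => ((Real.exp (-(t * |r| ^ (2*s))) : ℝ) : ℂ))) := by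
      rw [hF]
      exact ((hi.comp_mul_left' (R := 2 * π) (by positivity)).const_mul (2 * π)).ofReal
    have hinv := congrFun (hc.fourierInv_fourier_eq hphi hFi) (-ξ)
    rw [hF, Real.fourierInv_eq'] at hinv
    simp only [abs_neg] at hinv
    rw [← hinv]
    have hsub := Measure.integral_comp_mul_left
      (fun x : ℝ => (fracHeatKernel s t x : ℂ) * Complex.exp (-(Complex.I * x * ξ))) (2 * π)
    rw [abs_of_pos (by positivity : 0 < (2 * π)⁻¹), eq_inv_smul_iff₀ (by positivity)] at hsub
    rw [← hsub, ← integral_smul]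
    congr 1; ext v
    simp only [smul_eq_mul, Complex.real_smul, RCLike.inner_apply, conj_trivial]
    have : -(Complex.I * ((2 * π * v : ℝ) : ℂ) * ξ)
      = ((2 * π * (-ξ * v) : ℝ) : ℂ) * Complex.I := by push_cast; ring
    rw [this]
    push_cast
    ring
  refine ⟨hi, hmain, ?_⟩
  have h0 := hmain 0
  simp only [Complex.ofReal_zero, mul_zero, neg_zero, Complex.exp_zero, mul_one, abs_zero,
    Real.zero_rpow (by linarith [hs.1] : 2 * s ≠ 0), Real.exp_zero] at h0
  rw [integral_complex_ofReal] at h0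
  exact_mod_cast h0
end
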